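/- arXiv:nlin/0412066 — 6 statements merged into one kernel-verified Lean document; each statement's English description precedes it below -/
import Mathlib

section
/- Let f, g, ψ, A, B, G be differentiable complex-valued functions on an interval of ℝ such that A′ = f g′, B′ = f′ g, G′ = g ψ′, A + B = f g, and A and B vanish nowhere. Then (g/A)·(ψ − f G/B)′ = −(G/B)′. (The key integral identity (3.14)–(3.15) in the proof of the generalized Darboux transformation, Theorem 4.2, stated in differentiated pointwise form.) -/
noncomputable section

/-- The key integral identity (3.14)–(3.15) in the proof of the generalized Darboux
transformation (Theorem 4.2), in differentiated pointwise form: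
`(g/A)·(ψ - f·G/B)′ = -(G/B)′` on an interval where `A′ = f g′`, `B′ = f′ g`,
`G′ = g ψ′`, `A + B = f g`, and `A`, `B` vanish nowhere. -/
theorem generalized_darboux_key_integral_identity
    (s : Set ℝ) (hs : s.OrdConnected)
    (f g ψ A B G : ℝ → ℂ)
    (hfd : ∀ x ∈ s, DifferentiableAt ℝ f x)
    (hgd : ∀ x ∈ s, DifferentiableAt ℝ g x)
    (hψd : ∀ x ∈ s, DifferentiableAt ℝ ψ x)
    (hAd : ∀ x ∈ s, DifferentiableAt ℝ A x)
    (hBd : ∀ x ∈ s, DifferentiableAt ℝ B x)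
    (hGd : ∀ x ∈ s, DifferentiableAt ℝ G x)
    (hA' : ∀ x ∈ s, deriv A x = f x * deriv g x)
    (hB' : ∀ x ∈ s, deriv B x = deriv f x * g x)
    (hG' : ∀ x ∈ s, deriv G x = g x * deriv ψ x)
    (hAB : ∀ x ∈ s, A x + B x = f x * g x)
    (hAne : ∀ x ∈ s, A x ≠ 0) (hBne : ∀ x ∈ s, B x ≠ 0) :
    ∀ x ∈ s,
      g x / A x * deriv (fun z => ψ z - f z * G z / B z) x
        = -(deriv (fun z => G z / B z) x) := by
  intro x hx
  have hB0 := hBne x hx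
  have hA0 := hAne x hx
  have hf := (hfd x hx).hasDerivAt
  have hψ := (hψd x hx).hasDerivAt
  have hB := (hBd x hx).hasDerivAt
  have hG := (hGd x hx).hasDerivAt
  rw [hB' x hx] at hB
  rw [hG' x hx] at hG
  have hleft : deriv (fun z => ψ z - f z * G z / B z) x = _ :=
    (hψ.sub ((hf.mul hG).div hB hB0)).deriv
  have hright : deriv (fun z => G z / B z) x = _ := (hG.div hB hB0).deriv
  rw [hleft, hright]
  simp only [Pi.mul_apply]
  field_simp
  linear_combination (g x * (deriv ψ x * B x - deriv f x * G x)) * hAB x hx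

end
end

section
/- Let f, g, ψ, Φ, A, B, G, P, Q, R be differentiable complex-valued functions on an interval of ℝ such that A′ = f g′, B′ = f′ g, A + B = f g, G′ = g ψ′, P′ = Φ ψ′, Q′ = Φ f′, R′ = f Φ′, R + Q = f Φ, and A and B vanish nowhere. Set ψ[1] = ψ − f G/B and Φ[1] = Φ − g R/A. Then Φ[1]·(ψ[1])′ = (P − G Q/B)′. (The key identity behind equation (3.11) in the proof of Theorem 4.1: the transformed source integral I[Φ[1](ψ[1])_x] equals I[Φ ψ_x] − I[g ψ_x]·I[Φ f_x]/B.) -/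
noncomputable section

/-- The key identity behind equation (3.11) in the proof of Theorem 4.1, in
differentiated pointwise form: with `ψ[1] = ψ - f·G/B` and `Φ[1] = Φ - g·R/A`,
one has `Φ[1]·(ψ[1])′ = (P - G·Q/B)′` (i.e. the transformed source integral
`I[Φ[1](ψ[1])_x]` equals `I[Φ ψ_x] - I[g ψ_x]·I[Φ f_x]/B`). -/
theorem darboux_transformed_source_integral_identity
    (s : Set ℝ) (hs : s.OrdConnected)
    (f g ψ Φ A B G P Q R : ℝ → ℂ)
    (hfd : ∀ x ∈ s, DifferentiableAt ℝ f x)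
    (hgd : ∀ x ∈ s, DifferentiableAt ℝ g x)
    (hψd : ∀ x ∈ s, DifferentiableAt ℝ ψ x)
    (hΦd : ∀ x ∈ s, DifferentiableAt ℝ Φ x)
    (hAd : ∀ x ∈ s, DifferentiableAt ℝ A x)
    (hBd : ∀ x ∈ s, DifferentiableAt ℝ B x)
    (hGd : ∀ x ∈ s, DifferentiableAt ℝ G x)
    (hPd : ∀ x ∈ s, DifferentiableAt ℝ P x)
    (hQd : ∀ x ∈ s, DifferentiableAt ℝ Q x)
    (hRd : ∀ x ∈ s, DifferentiableAt ℝ R x)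
    (hA' : ∀ x ∈ s, deriv A x = f x * deriv g x)
    (hB' : ∀ x ∈ s, deriv B x = deriv f x * g x)
    (hAB : ∀ x ∈ s, A x + B x = f x * g x)
    (hG' : ∀ x ∈ s, deriv G x = g x * deriv ψ x)
    (hP' : ∀ x ∈ s, deriv P x = Φ x * deriv ψ x)
    (hQ' : ∀ x ∈ s, deriv Q x = Φ x * deriv f x)
    (hR' : ∀ x ∈ s, deriv R x = f x * deriv Φ x)
    (hRQ : ∀ x ∈ s, R x + Q x = f x * Φ x)
    (hAne : ∀ x ∈ s, A x ≠ 0) (hBne : ∀ x ∈ s, B x ≠ 0) :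
    ∀ x ∈ s,
      (Φ x - g x * R x / A x) * deriv (fun z => ψ z - f z * G z / B z) x
        = deriv (fun z => P z - G z * Q z / B z) x := by
  intro x hx
  have hA0 := hAne x hx
  have hB0 := hBne x hx
  have f' := (hfd x hx).hasDerivAt
  have ψ' := (hψd x hx).hasDerivAt
  have B' := (hBd x hx).hasDerivAt
  have G' := (hGd x hx).hasDerivAt
  have P' := (hPd x hx).hasDerivAt
  have Q' := (hQd x hx).hasDerivAt
  have hL : deriv (fun z => ψ z - f z * G z / B z) x = _ :=
    (ψ'.sub ((f'.mul G').div B' hB0)).deriv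
  have hR : deriv (fun z => P z - G z * Q z / B z) x = _ :=
    (P'.sub ((G'.mul Q').div B' hB0)).deriv
  rw [hL, hR]
  simp only [Pi.mul_apply]
  rw [hB' x hx, hG' x hx, hP' x hx, hQ' x hx]
  have hψ₁ : deriv ψ x - ((deriv f x * G x + f x * (g x * deriv ψ x)) * B x
      - f x * G x * (deriv f x * g x)) / B x ^ 2
      = -(A x / B x) * (deriv ψ x - deriv f x * G x / B x) := by
    rw [eq_sub_of_add_eq (hAB x hx)]
    field_simp
    ring
  have hΦ₁ : Φ x - g x * R x / A x = -(B x / A x) * (Φ x - g x * Q x / B x) := by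
    field_simp
    linear_combination Φ x * hAB x hx - g x * hRQ x hx
  rw [hψ₁, hΦ₁]
  field_simp
  ring

end
end

section
/- Let α ∈ ℂ be nonzero and let u, f, g, ψ, A, B, G be C^∞ complex-valued functions on an open subset of ℝ² (variables x, y) satisfying: α f_y = f_{xx} − 2u f_x, α g_y = −g_{xx} − 2u g_x, α ψ_y = ψ_{xx} − 2u ψ_x; A_x = f g_x and α A_y = f_x g_x − f g_{xx} − 2u f g_x; B_x = f_x g and α B_y = f_{xx} g − f_x g_x − 2u f_x g; G_x = g ψ_x and α G_y = ψ_{xx} g − ψ_x g_x − 2u ψ_x g; A + B = f g; and A, B vanish nowhere. Set u[1] = u + A_x/A − B_x/B and ψ[1] = ψ − f G/B. Then α (ψ[1])_y = (ψ[1])_{xx} − 2 u[1] (ψ[1])_x. (Covariance of the first spectral equation α ψ_y = ψ_{xx} − 2u ψ_x under the Darboux transformation, part of Theorems 4.1 and 4.2.) -/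
noncomputable section

/-- Complex-valued functions of `(x, y) ∈ ℝ²`. -/
abbrev F2 := ℝ → ℝ → ℂ

/-- `C^∞` smoothness on a subset of `ℝ²`. -/
def Smooth2On (Ω : Set (ℝ × ℝ)) (f : F2) : Prop :=
  ContDiffOn ℝ (⊤ : ℕ∞) (fun p : ℝ × ℝ => f p.1 p.2) Ω

/-- partial derivative in `x`. -/
def px2 (f : F2) : F2 := fun x y => deriv (fun s => f s y) x

/-- partial derivative in `y`. -/
def py2 (f : F2) : F2 := fun x y => deriv (fun s => f x s) y

theorem Smooth2On.contDiffOn_slice_x {Ω : Set (ℝ × ℝ)} {f : F2} (hf : Smooth2On Ω f) (y : ℝ) :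
    ContDiffOn ℝ (⊤ : ℕ∞) (fun s => f s y) {s | (s, y) ∈ Ω} :=
  ContDiffOn.comp hf (f := fun s : ℝ => (s, y)) (by fun_prop) fun _ hs => hs

theorem isOpen_slice_x {Ω : Set (ℝ × ℝ)} (hΩ : IsOpen Ω) (y : ℝ) :
    IsOpen {s : ℝ | (s, y) ∈ Ω} :=
  hΩ.preimage (f := fun s : ℝ => (s, y)) (by fun_prop)

theorem Smooth2On.hasDerivAt_x {Ω : Set (ℝ × ℝ)} (hΩ : IsOpen Ω) {f : F2} (hf : Smooth2On Ω f)
    {x y : ℝ} (h : (x, y) ∈ Ω) : HasDerivAt (fun s => f s y) (px2 f x y) x :=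
  (((hf.contDiffOn_slice_x y).contDiffAt ((isOpen_slice_x hΩ y).mem_nhds h)).differentiableAt
    (by simp)).hasDerivAt

theorem Smooth2On.hasDerivAt_px2_x {Ω : Set (ℝ × ℝ)} (hΩ : IsOpen Ω) {f : F2}
    (hf : Smooth2On Ω f) {x y : ℝ} (h : (x, y) ∈ Ω) :
    HasDerivAt (fun s => px2 f s y) (px2 (px2 f) x y) x :=
  ((((hf.contDiffOn_slice_x y).deriv_of_isOpen (m := 1) (isOpen_slice_x hΩ y)
    (by norm_cast)).contDiffAt
      ((isOpen_slice_x hΩ y).mem_nhds h)).differentiableAt one_ne_zero).hasDerivAt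

theorem Smooth2On.hasDerivAt_y {Ω : Set (ℝ × ℝ)} (hΩ : IsOpen Ω) {f : F2} (hf : Smooth2On Ω f)
    {x y : ℝ} (h : (x, y) ∈ Ω) : HasDerivAt (fun s => f x s) (py2 f x y) y := by
  have h1 : DifferentiableAt ℝ (fun p : ℝ × ℝ => f p.1 p.2) (x, y) :=
    (ContDiffOn.contDiffAt hf (hΩ.mem_nhds h)).differentiableAt (by simp)
  exact (DifferentiableAt.comp y (f := fun s : ℝ => (x, s)) h1 (by fun_prop)).hasDerivAt

/-- Covariance of the first spectral equation `α ψ_y = ψ_xx - 2u ψ_x` under the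
Darboux transformation (part of Theorems 4.1 and 4.2). -/
theorem darboux_covariance_spectral_equation
    (α : ℂ) (hα : α ≠ 0) (Ω : Set (ℝ × ℝ)) (hΩ : IsOpen Ω)
    (u f g ψ A B G : F2)
    (hu : Smooth2On Ω u) (hf : Smooth2On Ω f) (hg : Smooth2On Ω g)
    (hψ : Smooth2On Ω ψ) (hA : Smooth2On Ω A) (hB : Smooth2On Ω B)
    (hG : Smooth2On Ω G)
    (hfe : ∀ x y, (x, y) ∈ Ω →
      α * py2 f x y = px2 (px2 f) x y - 2 * u x y * px2 f x y)
    (hge : ∀ x y, (x, y) ∈ Ω →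
      α * py2 g x y = -(px2 (px2 g) x y) - 2 * u x y * px2 g x y)
    (hψe : ∀ x y, (x, y) ∈ Ω →
      α * py2 ψ x y = px2 (px2 ψ) x y - 2 * u x y * px2 ψ x y)
    (hAx : ∀ x y, (x, y) ∈ Ω → px2 A x y = f x y * px2 g x y)
    (hAy : ∀ x y, (x, y) ∈ Ω →
      α * py2 A x y = px2 f x y * px2 g x y - f x y * px2 (px2 g) x y
        - 2 * u x y * f x y * px2 g x y)
    (hBx : ∀ x y, (x, y) ∈ Ω → px2 B x y = px2 f x y * g x y)
    (hBy : ∀ x y, (x, y) ∈ Ω →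
      α * py2 B x y = px2 (px2 f) x y * g x y - px2 f x y * px2 g x y
        - 2 * u x y * px2 f x y * g x y)
    (hGx : ∀ x y, (x, y) ∈ Ω → px2 G x y = g x y * px2 ψ x y)
    (hGy : ∀ x y, (x, y) ∈ Ω →
      α * py2 G x y = px2 (px2 ψ) x y * g x y - px2 ψ x y * px2 g x y
        - 2 * u x y * px2 ψ x y * g x y)
    (hAB : ∀ x y, (x, y) ∈ Ω → A x y + B x y = f x y * g x y)
    (hAne : ∀ x y, (x, y) ∈ Ω → A x y ≠ 0)
    (hBne : ∀ x y, (x, y) ∈ Ω → B x y ≠ 0)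
    (u1 : F2) (hu1 : u1 = fun x y =>
      u x y + px2 A x y / A x y - px2 B x y / B x y)
    (ψ1 : F2) (hψ1 : ψ1 = fun x y => ψ x y - f x y * G x y / B x y) :
    ∀ x y, (x, y) ∈ Ω →
      α * py2 ψ1 x y = px2 (px2 ψ1) x y - 2 * u1 x y * px2 ψ1 x y := by
  have hψ1x : ∀ x y, (x, y) ∈ Ω → px2 ψ1 x y =
      A x y * (G x y * px2 f x y - B x y * px2 ψ x y) / B x y ^ 2 := by
    intro x y h
    have hB0 := hBne x y h
    have hd := (hψ.hasDerivAt_x hΩ h).sub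
      (((hf.hasDerivAt_x hΩ h).mul (hG.hasDerivAt_x hΩ h)).div (hB.hasDerivAt_x hΩ h) hB0)
    rw [hψ1]
    refine hd.deriv.trans ?_
    simp only [Pi.mul_apply]
    rw [hGx x y h, hBx x y h, eq_sub_of_add_eq (hAB x y h)]
    field_simp
    ring
  intro x y h
  have hA0 := hAne x y h
  have hB0 := hBne x y h
  have hψ1xx : px2 (px2 ψ1) x y =
      (px2 A x y * (G x y * px2 f x y - B x y * px2 ψ x y)
        + A x y * (G x y * px2 (px2 f) x y - B x y * px2 (px2 ψ) x y)) / B x y ^ 2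
      - 2 * A x y * (G x y * px2 f x y - B x y * px2 ψ x y) * px2 B x y / B x y ^ 3 := by
    have hd := ((hA.hasDerivAt_x hΩ h).mul
      (((hG.hasDerivAt_x hΩ h).mul (hf.hasDerivAt_px2_x hΩ h)).sub
        ((hB.hasDerivAt_x hΩ h).mul (hψ.hasDerivAt_px2_x hΩ h)))).div
      ((hB.hasDerivAt_x hΩ h).pow 2) (pow_ne_zero 2 hB0)
    have hev : (fun s => px2 ψ1 s y) =ᶠ[nhds x] fun s =>
        A s y * (G s y * px2 f s y - B s y * px2 ψ s y) / B s y ^ 2 :=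
      Filter.eventually_of_mem ((isOpen_slice_x hΩ y).mem_nhds h) fun s hs => hψ1x s y hs
    refine (hev.deriv_eq.trans hd.deriv).trans ?_
    simp only [Pi.mul_apply, Pi.sub_apply, Pi.pow_apply]
    rw [hGx x y h, hBx x y h]
    field_simp
    ring
  have hψ1y : α * py2 ψ1 x y = α * py2 ψ x y
      - ((α * py2 f x y) * G x y + f x y * (α * py2 G x y)) / B x y
      + f x y * G x y * (α * py2 B x y) / B x y ^ 2 := by
    have hd := (hψ.hasDerivAt_y hΩ h).sub
      (((hf.hasDerivAt_y hΩ h).mul (hG.hasDerivAt_y hΩ h)).div (hB.hasDerivAt_y hΩ h) hB0)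
    rw [hψ1]
    refine (congrArg (α * ·) hd.deriv).trans ?_
    simp only [Pi.mul_apply]
    field_simp
    ring
  rw [hψ1y, hψ1xx, hψ1x x y h, hu1, hψe x y h, hfe x y h, hGy x y h, hBy x y h]
  simp only
  rw [hAx x y h, hBx x y h, eq_sub_of_add_eq (hAB x y h)]
  rw [eq_sub_of_add_eq (hAB x y h)] at hA0
  field_simp
  ring

end
end

section
/- Let k, a, b ∈ ℝ with k ≠ 0, and set A(x,y,t) = 2x + 8ky − 96k²t − 8abt/(9k). Let Ω ⊆ ℝ³ be the open set where (2kA + 1)(2kA − 1) ≠ 0. Define on Ω: u = 8k/((2kA + 1)(2kA − 1)), Ψ₁ = 3b e^{−kx + k²y} (A + 1/(6k))/(A + 1/(2k)), Φ₁ = (a/3) e^{kx − k²y} (A − 1/(6k))/(A − 1/(2k)), and w = 32k²/((2kA + 1)(2kA − 1)). Then w_x = u_y and (u, Ψ₁, Φ₁, w) is a solution on Ω of the mKPIIESCS (α = 1) of degree 1. (Rational solution with singularities of the mKPII equation with self-consistent sources, Example 1.) -/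
noncomputable section

/-- Complex-valued functions of `(x, y, t) ∈ ℝ³`. -/
abbrev F3 := ℝ → ℝ → ℝ → ℂ

/-- partial derivative in `x`. -/
def px (f : F3) : F3 := fun x y t => deriv (fun s => f s y t) x

/-- partial derivative in `y`. -/
def py (f : F3) : F3 := fun x y t => deriv (fun s => f x s t) y

/-- partial derivative in `t`. -/
def pt (f : F3) : F3 := fun x y t => deriv (fun s => f x y s) t

/-- pointwise product. -/
def fmul (p q : F3) : F3 := fun x y t => p x y t * q x y t

/-- `C^∞` smoothness on a subset of `ℝ³`. -/
def Smooth3On (Ω : Set (ℝ × ℝ × ℝ)) (f : F3) : Prop :=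
  ContDiffOn ℝ (⊤ : ℕ∞) (fun p : ℝ × ℝ × ℝ => f p.1 p.2.1 p.2.2) Ω

/-- `(u, Ψ₁, …, Ψ_N, Φ₁, …, Φ_N, w)` is a solution on `Ω` of the mKP equation with
self-consistent sources (mKPESCS) of degree `N` (for the constant `α`);
`w` plays the role of the antiderivative `D⁻¹(u_y)`. -/
def IsMKPESCSOn (α : ℂ) (Ω : Set (ℝ × ℝ × ℝ)) (N : ℕ)
    (u : F3) (Ψ Φ : Fin N → F3) (w : F3) : Prop :=
  Smooth3On Ω u ∧ Smooth3On Ω w ∧ (∀ i, Smooth3On Ω (Ψ i)) ∧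
  (∀ i, Smooth3On Ω (Φ i)) ∧
  (∀ x y t, (x, y, t) ∈ Ω → px w x y t = py u x y t) ∧
  (∀ x y t, (x, y, t) ∈ Ω →
    pt u x y t + px (px (px u)) x y t + 3 * α ^ 2 * py w x y t
      - 6 * α * w x y t * px u x y t - 6 * (u x y t) ^ 2 * px u x y t
      + 4 * ∑ i, px (fmul (Ψ i) (Φ i)) x y t = 0) ∧
  (∀ i, ∀ x y t, (x, y, t) ∈ Ω → α * py (Ψ i) x y t
      = px (px (Ψ i)) x y t - 2 * u x y t * px (Ψ i) x y t) ∧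
  (∀ i, ∀ x y t, (x, y, t) ∈ Ω → α * py (Φ i) x y t
      = -(px (px (Φ i)) x y t) - 2 * u x y t * px (Φ i) x y t)

/-- The complex linear form with coefficients `c₁, c₂, c₃` on `ℝ³`. -/
def linForm (c₁ c₂ c₃ : ℂ) : F3 := fun x y t => c₁ * x + c₂ * y + c₃ * t

lemma hasDerivAt_linForm_x (c₁ c₂ c₃ : ℂ) (x y t : ℝ) :
    HasDerivAt (fun s => linForm c₁ c₂ c₃ s y t) c₁ x := by
  simpa [linForm] using (((Complex.ofRealCLM.hasDerivAt (x := x)).const_mul c₁).add_const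
    (c₂ * y)).add_const (c₃ * t)

lemma hasDerivAt_linForm_y (c₁ c₂ c₃ : ℂ) (x y t : ℝ) :
    HasDerivAt (fun s => linForm c₁ c₂ c₃ x s t) c₂ y := by
  simpa [linForm] using (((Complex.ofRealCLM.hasDerivAt (x := y)).const_mul c₂).const_add
    (c₁ * x)).add_const (c₃ * t)

lemma hasDerivAt_linForm_t (c₁ c₂ c₃ : ℂ) (x y t : ℝ) :
    HasDerivAt (fun s => linForm c₁ c₂ c₃ x y s) c₃ t := by
  simpa [linForm] using ((Complex.ofRealCLM.hasDerivAt (x := t)).const_mul c₃).const_add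
    (c₁ * x + c₂ * y)

lemma contDiff_linForm (c₁ c₂ c₃ : ℂ) :
    ContDiff ℝ (⊤ : ℕ∞) (fun p : ℝ × ℝ × ℝ => linForm c₁ c₂ c₃ p.1 p.2.1 p.2.2) := by
  have hx : ContDiff ℝ (⊤ : ℕ∞) (fun p : ℝ × ℝ × ℝ => (p.1 : ℂ)) :=
    Complex.ofRealCLM.contDiff.comp contDiff_fst
  have hy : ContDiff ℝ (⊤ : ℕ∞) (fun p : ℝ × ℝ × ℝ => (p.2.1 : ℂ)) :=
    Complex.ofRealCLM.contDiff.comp (contDiff_fst.comp contDiff_snd)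
  have ht : ContDiff ℝ (⊤ : ℕ∞) (fun p : ℝ × ℝ × ℝ => (p.2.2 : ℂ)) :=
    Complex.ofRealCLM.contDiff.comp (contDiff_snd.comp contDiff_snd)
  exact ((contDiff_const.mul hx).add (contDiff_const.mul hy)).add (contDiff_const.mul ht)

lemma px_congr_of_isOpen {Ω : Set (ℝ × ℝ × ℝ)} (hΩ : IsOpen Ω) {f g : F3}
    (h : ∀ x y t, (x, y, t) ∈ Ω → f x y t = g x y t) (x y t : ℝ) (hp : (x, y, t) ∈ Ω) :
    px f x y t = px g x y t := by
  refine Filter.EventuallyEq.deriv_eq ?_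
  have hc : Continuous (fun s : ℝ => (s, y, t)) := by fun_prop
  filter_upwards [(hΩ.preimage hc).mem_nhds hp] with s hs using h s y t hs

/-- If `z` moves with velocity `z'`, then `(z² - 1)⁻¹` moves with velocity
`-2 z z' (z² - 1)⁻²`. -/
lemma HasDerivAt.inv_add_one_mul_sub_one {z : ℝ → ℂ} {z' : ℂ} {s : ℝ}
    (hz : HasDerivAt z z' s) (h : (z s + 1) * (z s - 1) ≠ 0) :
    HasDerivAt (fun r => ((z r + 1) * (z r - 1))⁻¹)
      (-2 * z s * z' * (((z s + 1) * (z s - 1))⁻¹) ^ 2) s := by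
  refine (((hz.add_const 1).mul (hz.sub_const 1)).inv h).congr_deriv ?_
  simp only [Pi.mul_apply]
  field_simp
  ring

/-- The derivative of a Möbius-type wave `c e^θ (z + m) / (z + n)` along a curve. -/
lemma HasDerivAt.exp_mul_mobius {z θ : ℝ → ℂ} {z' θ' : ℂ} {s : ℝ} (c m n : ℂ)
    (hz : HasDerivAt z z' s) (hθ : HasDerivAt θ θ' s) (h : z s + n ≠ 0) :
    HasDerivAt (fun r => c * Complex.exp (θ r) * ((z r + m) / (z r + n)))
      (c * Complex.exp (θ s) * (θ' * ((z s + m) / (z s + n)) + z' * (n - m) / (z s + n) ^ 2)) s := by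
  refine ((hθ.cexp.const_mul c).mul ((hz.add_const m).div (hz.add_const n) h)).congr_deriv ?_
  simp only [Pi.div_apply]
  field_simp
  ring

/-- The second derivative of a Möbius-type wave `c e^θ (z + m) / (z + n)` along a curve of
constant velocity. -/
lemma HasDerivAt.deriv_exp_mul_mobius {z θ : ℝ → ℂ} {z' θ' : ℂ} {s : ℝ} (c m n : ℂ)
    (hz : HasDerivAt z z' s) (hθ : HasDerivAt θ θ' s) (h : z s + n ≠ 0) :
    HasDerivAt (fun r => c * Complex.exp (θ r) *
        (θ' * ((z r + m) / (z r + n)) + z' * (n - m) / (z r + n) ^ 2))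
      (c * Complex.exp (θ s) * (θ' ^ 2 * ((z s + m) / (z s + n))
        + 2 * θ' * z' * (n - m) / (z s + n) ^ 2 - 2 * z' ^ 2 * (n - m) / (z s + n) ^ 3)) s := by
  have h2 : (z s + n) ^ 2 ≠ 0 := pow_ne_zero 2 h
  refine ((hθ.cexp.const_mul c).mul
    ((((hz.add_const m).div (hz.add_const n) h).const_mul θ').add
      ((hasDerivAt_const s (z' * (n - m))).div ((hz.add_const n).pow 2) h2))).congr_deriv ?_
  simp only [Pi.add_apply, Pi.div_apply, Pi.pow_apply]
  field_simp
  ring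

/-- **Example 1**: rational solution with singularities of the mKPII equation with
self-consistent sources (`α = 1`) of degree 1. -/
theorem mKPIIESCS_rational_solution
    (k a b : ℝ) (hk : k ≠ 0)
    (A : ℝ → ℝ → ℝ → ℝ)
    (hA : A = fun x y t => 2 * x + 8 * k * y - 96 * k ^ 2 * t - 8 * a * b * t / (9 * k))
    (Ω : Set (ℝ × ℝ × ℝ))
    (hΩ : Ω = {p : ℝ × ℝ × ℝ |
      (2 * k * A p.1 p.2.1 p.2.2 + 1) * (2 * k * A p.1 p.2.1 p.2.2 - 1) ≠ 0})
    (u : F3) (hu : u = fun x y t =>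
      ((8 * k : ℝ) : ℂ) / (((2 * k * A x y t + 1) * (2 * k * A x y t - 1) : ℝ) : ℂ))
    (Ψ₁ : F3) (hΨ₁ : Ψ₁ = fun x y t =>
      ((3 * b : ℝ) : ℂ) * Complex.exp ((-k * x + k ^ 2 * y : ℝ) : ℂ)
        * (((A x y t + 1 / (6 * k) : ℝ) : ℂ) / ((A x y t + 1 / (2 * k) : ℝ) : ℂ)))
    (Φ₁ : F3) (hΦ₁ : Φ₁ = fun x y t =>
      ((a / 3 : ℝ) : ℂ) * Complex.exp ((k * x - k ^ 2 * y : ℝ) : ℂ)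
        * (((A x y t - 1 / (6 * k) : ℝ) : ℂ) / ((A x y t - 1 / (2 * k) : ℝ) : ℂ)))
    (w : F3) (hw : w = fun x y t =>
      ((32 * k ^ 2 : ℝ) : ℂ)
        / (((2 * k * A x y t + 1) * (2 * k * A x y t - 1) : ℝ) : ℂ)) :
    (∀ x y t, (x, y, t) ∈ Ω → px w x y t = py u x y t) ∧
    IsMKPESCSOn 1 Ω 1 u (fun _ => Ψ₁) (fun _ => Φ₁) w := by
  have hkC : (k : ℂ) ≠ 0 := by exact_mod_cast hk
  set Z : F3 := linForm (4 * k) (16 * k ^ 2) (-192 * k ^ 3 - 16 * a * b / 9) with hZ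
  set θ : F3 := linForm (-k) (k ^ 2) 0 with hθ
  set η : F3 := linForm k (-k ^ 2) 0 with hη
  set H : F3 := fun x y t => ((Z x y t + 1) * (Z x y t - 1))⁻¹ with hH
  have hZA : ∀ x y t, ((2 * k * A x y t : ℝ) : ℂ) = Z x y t := by
    intro x y t
    simp only [hA, hZ, linForm]
    push_cast
    field_simp
    ring
  have hAZ : ∀ x y t, (A x y t : ℂ) = Z x y t / (2 * k) := by
    intro x y t
    rw [← hZA]
    push_cast
    field_simp
  have hden : ∀ x y t, (((2 * k * A x y t + 1) * (2 * k * A x y t - 1) : ℝ) : ℂ)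
      = (Z x y t + 1) * (Z x y t - 1) := by
    intro x y t
    rw [← hZA]
    push_cast
    ring
  have hmem : ∀ x y t, (x, y, t) ∈ Ω → (Z x y t + 1) * (Z x y t - 1) ≠ 0 := by
    intro x y t hp
    rw [hΩ] at hp
    rw [← hden]
    exact_mod_cast hp
  have hp1 : ∀ x y t, (x, y, t) ∈ Ω → Z x y t + 1 ≠ 0 :=
    fun x y t hp => left_ne_zero_of_mul (hmem x y t hp)
  have hm1 : ∀ x y t, (x, y, t) ∈ Ω → Z x y t + -1 ≠ 0 := by
    intro x y t hp
    rw [← sub_eq_add_neg]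
    exact right_ne_zero_of_mul (hmem x y t hp)
  have hopen : IsOpen Ω := by
    rw [hΩ, hA]
    exact isOpen_ne_fun (by fun_prop) continuous_const
  have hu' : u = fun x y t => 8 * k * H x y t := by
    rw [hu]
    funext x y t
    rw [hden, div_eq_mul_inv]
    push_cast
    rfl
  have hw' : w = fun x y t => 32 * k ^ 2 * H x y t := by
    rw [hw]
    funext x y t
    rw [hden, div_eq_mul_inv]
    push_cast
    rfl
  have hΨ' : Ψ₁ = fun x y t => 3 * b * Complex.exp (θ x y t)
      * ((Z x y t + 1 / 3) / (Z x y t + 1)) := by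
    rw [hΨ₁]
    funext x y t
    have e₁ : ((A x y t + 1 / (6 * k) : ℝ) : ℂ) = (Z x y t + 1 / 3) / (2 * k) := by
      push_cast
      rw [hAZ]
      field_simp
      ring
    have e₂ : ((A x y t + 1 / (2 * k) : ℝ) : ℂ) = (Z x y t + 1) / (2 * k) := by
      push_cast
      rw [hAZ]
      field_simp
    have e₃ : ((-k * x + k ^ 2 * y : ℝ) : ℂ) = θ x y t := by
      simp only [hθ, linForm]
      push_cast
      ring
    rw [e₁, e₂, e₃, div_div_div_cancel_right₀ (by simpa using hk)]
    push_cast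
    rfl
  have hΦ' : Φ₁ = fun x y t => a / 3 * Complex.exp (η x y t)
      * ((Z x y t + -1 / 3) / (Z x y t + -1)) := by
    rw [hΦ₁]
    funext x y t
    have e₁ : ((A x y t - 1 / (6 * k) : ℝ) : ℂ) = (Z x y t + -1 / 3) / (2 * k) := by
      push_cast
      rw [hAZ]
      field_simp
      ring
    have e₂ : ((A x y t - 1 / (2 * k) : ℝ) : ℂ) = (Z x y t + -1) / (2 * k) := by
      push_cast
      rw [hAZ]
      field_simp
      ring
    have e₃ : ((k * x - k ^ 2 * y : ℝ) : ℂ) = η x y t := by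
      simp only [hη, linForm]
      push_cast
      ring
    rw [e₁, e₂, e₃, div_div_div_cancel_right₀ (by simpa using hk)]
    push_cast
    rfl
  have hZx := hasDerivAt_linForm_x (4 * k) (16 * k ^ 2) (-192 * k ^ 3 - 16 * a * b / 9)
  have hZy := hasDerivAt_linForm_y (4 * k) (16 * k ^ 2) (-192 * k ^ 3 - 16 * a * b / 9)
  have hZt := hasDerivAt_linForm_t (4 * k) (16 * k ^ 2) (-192 * k ^ 3 - 16 * a * b / 9)
  have hθx := hasDerivAt_linForm_x (-k) (k ^ 2) 0
  have hθy := hasDerivAt_linForm_y (-k) (k ^ 2) 0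
  have hηx := hasDerivAt_linForm_x k (-k ^ 2) 0
  have hηy := hasDerivAt_linForm_y k (-k ^ 2) 0
  rw [← hZ] at hZx hZy hZt
  rw [← hθ] at hθx hθy
  rw [← hη] at hηx hηy
  have hHx : ∀ x y t, (x, y, t) ∈ Ω →
      HasDerivAt (fun s => H s y t) (-2 * Z x y t * (4 * k) * H x y t ^ 2) x :=
    fun x y t hp => (hZx x y t).inv_add_one_mul_sub_one (hmem x y t hp)
  have hHy : ∀ x y t, (x, y, t) ∈ Ω →
      HasDerivAt (fun s => H x s t) (-2 * Z x y t * (16 * k ^ 2) * H x y t ^ 2) y :=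
    fun x y t hp => (hZy x y t).inv_add_one_mul_sub_one (hmem x y t hp)
  have hHt : ∀ x y t, (x, y, t) ∈ Ω → HasDerivAt (fun s => H x y s)
      (-2 * Z x y t * (-192 * k ^ 3 - 16 * a * b / 9) * H x y t ^ 2) t :=
    fun x y t hp => (hZt x y t).inv_add_one_mul_sub_one (hmem x y t hp)
  have hux : ∀ x y t, (x, y, t) ∈ Ω →
      px u x y t = 8 * k * (-2 * Z x y t * (4 * k) * H x y t ^ 2) := by
    intro x y t hp
    rw [hu']
    exact ((hHx x y t hp).const_mul _).deriv
  have huxx : ∀ x y t, (x, y, t) ∈ Ω →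
      px (px u) x y t = 128 * k ^ 3 * (6 * H x y t ^ 2 + 8 * H x y t ^ 3) := by
    intro x y t hp
    rw [px_congr_of_isOpen hopen hux x y t hp]
    refine (((((hZx x y t).const_mul (-2)).mul_const (4 * (k : ℂ))).mul
      ((hHx x y t hp).pow 2)).const_mul (8 * (k : ℂ))).deriv.trans ?_
    have hinv : H x y t * ((Z x y t + 1) * (Z x y t - 1)) = 1 :=
      inv_mul_cancel₀ (hmem x y t hp)
    simp only [Pi.pow_apply]
    push_cast
    linear_combination 1024 * (k : ℂ) ^ 3 * H x y t ^ 2 * hinv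
  have huxxx : ∀ x y t, (x, y, t) ∈ Ω → px (px (px u)) x y t
      = 128 * k ^ 3 * (12 * H x y t + 24 * H x y t ^ 2)
        * (-2 * Z x y t * (4 * k) * H x y t ^ 2) := by
    intro x y t hp
    rw [px_congr_of_isOpen hopen huxx x y t hp]
    refine (((((hHx x y t hp).pow 2).const_mul 6).add
      (((hHx x y t hp).pow 3).const_mul 8)).const_mul (128 * (k : ℂ) ^ 3)).deriv.trans ?_
    push_cast
    ring
  have huy : ∀ x y t, (x, y, t) ∈ Ω →
      py u x y t = 8 * k * (-2 * Z x y t * (16 * k ^ 2) * H x y t ^ 2) := by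
    intro x y t hp
    rw [hu']
    exact ((hHy x y t hp).const_mul _).deriv
  have hut : ∀ x y t, (x, y, t) ∈ Ω → pt u x y t
      = 8 * k * (-2 * Z x y t * (-192 * k ^ 3 - 16 * a * b / 9) * H x y t ^ 2) := by
    intro x y t hp
    rw [hu']
    exact ((hHt x y t hp).const_mul _).deriv
  have hwx : ∀ x y t, (x, y, t) ∈ Ω →
      px w x y t = 32 * k ^ 2 * (-2 * Z x y t * (4 * k) * H x y t ^ 2) := by
    intro x y t hp
    rw [hw']
    exact ((hHx x y t hp).const_mul _).deriv
  have hwy : ∀ x y t, (x, y, t) ∈ Ω →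
      py w x y t = 32 * k ^ 2 * (-2 * Z x y t * (16 * k ^ 2) * H x y t ^ 2) := by
    intro x y t hp
    rw [hw']
    exact ((hHy x y t hp).const_mul _).deriv
  have hΨx : ∀ x y t, (x, y, t) ∈ Ω → px Ψ₁ x y t = 3 * b * Complex.exp (θ x y t)
      * (-k * ((Z x y t + 1 / 3) / (Z x y t + 1))
        + 4 * k * (1 - 1 / 3) / (Z x y t + 1) ^ 2) := by
    intro x y t hp
    rw [hΨ']
    exact ((hZx x y t).exp_mul_mobius _ _ _ (hθx x y t) (hp1 x y t hp)).deriv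
  have hΨxx : ∀ x y t, (x, y, t) ∈ Ω → px (px Ψ₁) x y t = 3 * b * Complex.exp (θ x y t)
      * ((-k) ^ 2 * ((Z x y t + 1 / 3) / (Z x y t + 1))
        + 2 * -k * (4 * k) * (1 - 1 / 3) / (Z x y t + 1) ^ 2
        - 2 * (4 * k) ^ 2 * (1 - 1 / 3) / (Z x y t + 1) ^ 3) := by
    intro x y t hp
    rw [px_congr_of_isOpen hopen hΨx x y t hp]
    exact ((hZx x y t).deriv_exp_mul_mobius _ _ _ (hθx x y t) (hp1 x y t hp)).deriv
  have hΨy : ∀ x y t, (x, y, t) ∈ Ω → py Ψ₁ x y t = 3 * b * Complex.exp (θ x y t)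
      * (k ^ 2 * ((Z x y t + 1 / 3) / (Z x y t + 1))
        + 16 * k ^ 2 * (1 - 1 / 3) / (Z x y t + 1) ^ 2) := by
    intro x y t hp
    rw [hΨ']
    exact ((hZy x y t).exp_mul_mobius _ _ _ (hθy x y t) (hp1 x y t hp)).deriv
  have hΦx : ∀ x y t, (x, y, t) ∈ Ω → px Φ₁ x y t = a / 3 * Complex.exp (η x y t)
      * (k * ((Z x y t + -1 / 3) / (Z x y t + -1))
        + 4 * k * (-1 - -1 / 3) / (Z x y t + -1) ^ 2) := by
    intro x y t hp
    rw [hΦ']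
    exact ((hZx x y t).exp_mul_mobius _ _ _ (hηx x y t) (hm1 x y t hp)).deriv
  have hΦxx : ∀ x y t, (x, y, t) ∈ Ω → px (px Φ₁) x y t = a / 3 * Complex.exp (η x y t)
      * (k ^ 2 * ((Z x y t + -1 / 3) / (Z x y t + -1))
        + 2 * k * (4 * k) * (-1 - -1 / 3) / (Z x y t + -1) ^ 2
        - 2 * (4 * k) ^ 2 * (-1 - -1 / 3) / (Z x y t + -1) ^ 3) := by
    intro x y t hp
    rw [px_congr_of_isOpen hopen hΦx x y t hp]
    exact ((hZx x y t).deriv_exp_mul_mobius _ _ _ (hηx x y t) (hm1 x y t hp)).deriv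
  have hΦy : ∀ x y t, (x, y, t) ∈ Ω → py Φ₁ x y t = a / 3 * Complex.exp (η x y t)
      * (-k ^ 2 * ((Z x y t + -1 / 3) / (Z x y t + -1))
        + 16 * k ^ 2 * (-1 - -1 / 3) / (Z x y t + -1) ^ 2) := by
    intro x y t hp
    rw [hΦ']
    exact ((hZy x y t).exp_mul_mobius _ _ _ (hηy x y t) (hm1 x y t hp)).deriv
  have hprod : ∀ x y t, (x, y, t) ∈ Ω →
      fmul Ψ₁ Φ₁ x y t = a * b * (1 + 8 / 9 * H x y t) := by
    intro x y t hp
    have hexp : Complex.exp (η x y t) = (Complex.exp (θ x y t))⁻¹ := by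
      rw [← Complex.exp_neg]
      congr 1
      simp only [hθ, hη, linForm]
      ring
    have hE := Complex.exp_ne_zero (θ x y t)
    have hne := hmem x y t hp
    have h₁ := hp1 x y t hp
    have h₂ := right_ne_zero_of_mul hne
    simp only [fmul, hΨ', hΦ', hH, hexp, ← sub_eq_add_neg]
    field_simp
    ring
  have hprodx : ∀ x y t, (x, y, t) ∈ Ω → px (fmul Ψ₁ Φ₁) x y t
      = a * b * (8 / 9 * (-2 * Z x y t * (4 * k) * H x y t ^ 2)) := by
    intro x y t hp
    rw [px_congr_of_isOpen hopen hprod x y t hp]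
    exact ((((hHx x y t hp).const_mul (8 / 9)).const_add 1).const_mul (a * b : ℂ)).deriv
  have hZs := (contDiff_linForm (4 * k) (16 * k ^ 2)
    (-192 * k ^ 3 - 16 * a * b / 9)).contDiffOn (s := Ω)
  have hHs : Smooth3On Ω H :=
    ((hZs.add contDiffOn_const).mul (hZs.sub contDiffOn_const)).inv
      fun p hp => hmem p.1 p.2.1 p.2.2 hp
  have hcompat : ∀ x y t, (x, y, t) ∈ Ω → px w x y t = py u x y t := by
    intro x y t hp
    rw [hwx x y t hp, huy x y t hp]
    ring
  refine ⟨hcompat, ?_, ?_, fun _ => ?_, fun _ => ?_, hcompat, ?_, fun _ => ?_, fun _ => ?_⟩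
  · rw [hu']
    exact contDiffOn_const.mul hHs
  · rw [hw']
    exact contDiffOn_const.mul hHs
  · rw [hΨ']
    simp only [Smooth3On, div_eq_mul_inv]
    exact (contDiffOn_const.mul (contDiff_linForm _ _ _).contDiffOn.cexp).mul
      ((hZs.add contDiffOn_const).mul ((hZs.add contDiffOn_const).inv
        fun p hp => hp1 p.1 p.2.1 p.2.2 hp))
  · rw [hΦ']
    simp only [Smooth3On, div_eq_mul_inv]
    exact (contDiffOn_const.mul (contDiff_linForm _ _ _).contDiffOn.cexp).mul
      ((hZs.add contDiffOn_const).mul ((hZs.add contDiffOn_const).inv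
        fun p hp => hm1 p.1 p.2.1 p.2.2 hp))
  · intro x y t hp
    simp only [Finset.univ_unique, Finset.sum_const, Finset.card_singleton, one_smul]
    rw [hut x y t hp, huxxx x y t hp, hwy x y t hp, hux x y t hp, hprodx x y t hp, hu', hw']
    ring
  · intro x y t hp
    have h₁ := hp1 x y t hp
    have h₂ := right_ne_zero_of_mul (hmem x y t hp)
    rw [hΨy x y t hp, hΨxx x y t hp, hΨx x y t hp, hu']
    simp only [hH]
    field_simp
    ring
  · intro x y t hp
    have h₁ := hp1 x y t hp
    have h₂ := right_ne_zero_of_mul (hmem x y t hp)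
    rw [hΦy x y t hp, hΦxx x y t hp, hΦx x y t hp, hu']
    simp only [hH, ← sub_eq_add_neg]
    field_simp
    ring

end
end

section
/- Let k, l ∈ ℝ with k + l ≠ 0, let β : ℝ → ℝ be C^∞, and let c : ℝ → ℂ be C^∞ with c(t)² = 2 dβ/dt. Set ξ₁ = kx + k²y − 4k³t, ξ₂ = lx − l²y − 4l³t, and η = (ξ₁ + ξ₂)/2 − β(t). Let Ω ⊆ ℝ³ be the open set where (k/(k+l)) e^{ξ₁+ξ₂} − e^{2β(t)} ≠ 0 and (l/(k+l)) e^{ξ₁+ξ₂} + e^{2β(t)} ≠ 0. Define on Ω: u = −(k+l)/[((k/(k+l)) e^{η} − e^{−η})((l/(k+l)) e^{η} + e^{−η})], Ψ₁ = −(c(t)/2) e^{ξ₁ + β(t)}/((k/(k+l)) e^{ξ₁+ξ₂} − e^{2β(t)}), Φ₁ = (c(t)/2) e^{ξ₂ + β(t)}/((l/(k+l)) e^{ξ₁+ξ₂} + e^{2β(t)}), and w = (k − l) u. Then w_x = u_y and (u, Ψ₁, Φ₁, w) is a solution on Ω of the mKPIIESCS (α = 1) of degree 1. (One-soliton solution of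 the mKPII equation with self-consistent sources, Example 3; the two exponential factors in the denominator of u are here assigned the coefficients k/(k+l) and l/(k+l) as dictated by the Darboux transformation.) -/
noncomputable section

section PartialDerivatives

variable {Ω : Set (ℝ × ℝ × ℝ)} {f g : F3}

/-- The partial derivative in `x` on an open set only depends on the function there. -/
lemma px_eq_of_eqOn (hΩ : IsOpen Ω) (hfg : ∀ x y t, (x, y, t) ∈ Ω → f x y t = g x y t)
    {x y t : ℝ} (h : (x, y, t) ∈ Ω) {d : ℂ} (hg : HasDerivAt (fun s => g s y t) d x) :
    px f x y t = d := by
  refine (hg.congr_of_eventuallyEq ?_).deriv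
  have hc : ContinuousAt (fun s : ℝ => (s, y, t)) x := by fun_prop
  filter_upwards [hc.eventually (hΩ.mem_nhds h)] with s hs using hfg _ _ _ hs

/-- The partial derivative in `y` on an open set only depends on the function there. -/
lemma py_eq_of_eqOn (hΩ : IsOpen Ω) (hfg : ∀ x y t, (x, y, t) ∈ Ω → f x y t = g x y t)
    {x y t : ℝ} (h : (x, y, t) ∈ Ω) {d : ℂ} (hg : HasDerivAt (fun s => g x s t) d y) :
    py f x y t = d := by
  refine (hg.congr_of_eventuallyEq ?_).deriv
  have hc : ContinuousAt (fun s : ℝ => (x, s, t)) y := by fun_prop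
  filter_upwards [hc.eventually (hΩ.mem_nhds h)] with s hs using hfg _ _ _ hs

/-- The partial derivative in `t` on an open set only depends on the function there. -/
lemma pt_eq_of_eqOn (hΩ : IsOpen Ω) (hfg : ∀ x y t, (x, y, t) ∈ Ω → f x y t = g x y t)
    {x y t : ℝ} (h : (x, y, t) ∈ Ω) {d : ℂ} (hg : HasDerivAt (fun s => g x y s) d t) :
    pt f x y t = d := by
  refine (hg.congr_of_eventuallyEq ?_).deriv
  have hc : ContinuousAt (fun s : ℝ => (x, y, s)) t := by fun_prop
  filter_upwards [hc.eventually (hΩ.mem_nhds h)] with s hs using hfg _ _ _ hs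

lemma Smooth3On.congr (hf : Smooth3On Ω g)
    (hfg : ∀ x y t, (x, y, t) ∈ Ω → f x y t = g x y t) : Smooth3On Ω f :=
  ContDiffOn.congr hf fun p hp => hfg p.1 p.2.1 p.2.2 hp

end PartialDerivatives

/-- The phase `ξ₁ + ξ₂ - 2β` of the soliton. -/
def solitonPhase (k l : ℝ) (β : ℝ → ℝ) (x y t : ℝ) : ℝ :=
  (k * x + k ^ 2 * y - 4 * k ^ 3 * t) + (l * x - l ^ 2 * y - 4 * l ^ 3 * t) - 2 * β t

/-- The logistic profile `(m e^θ + ε)⁻¹`, where `θ` is the soliton phase. -/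
def solitonProfile (k l : ℝ) (β : ℝ → ℝ) (m ε : ℝ) : F3 := fun x y t =>
  (((m * Real.exp (solitonPhase k l β x y t) + ε)⁻¹ : ℝ) : ℂ)

/-- The logistic profile solves a Riccati equation along any curve of phases. -/
lemma hasDerivAt_logistic {m ε θ' x : ℝ} {θ : ℝ → ℝ} (hθ : HasDerivAt θ θ' x)
    (h : m * Real.exp (θ x) + ε ≠ 0) :
    HasDerivAt (fun s => (((m * Real.exp (θ s) + ε)⁻¹ : ℝ) : ℂ))
      (-(θ' : ℂ) * ((((m * Real.exp (θ x) + ε)⁻¹ : ℝ) : ℂ)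
        - ε * (((m * Real.exp (θ x) + ε)⁻¹ : ℝ) : ℂ) ^ 2)) x := by
  refine (((hθ.exp.const_mul m).add_const ε).inv h).ofReal_comp.congr_deriv ?_
  simp only [← Complex.ofReal_pow, ← Complex.ofReal_mul, ← Complex.ofReal_sub,
    ← Complex.ofReal_neg]
  congr 1
  field_simp
  ring

section Profile

variable {k l : ℝ} {β : ℝ → ℝ} {m ε x y t : ℝ}

lemma hasDerivAt_solitonProfile_x
    (h : m * Real.exp (solitonPhase k l β x y t) + ε ≠ 0) :
    HasDerivAt (fun s => solitonProfile k l β m ε s y t)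
      (-(k + l) * (solitonProfile k l β m ε x y t
        - ε * solitonProfile k l β m ε x y t ^ 2)) x := by
  have hθ : HasDerivAt (fun s => solitonPhase k l β s y t) (k + l) x := by
    have h1 := (((hasDerivAt_id x).const_mul (k + l)).add_const
      (k ^ 2 * y - 4 * k ^ 3 * t - l ^ 2 * y - 4 * l ^ 3 * t - 2 * β t))
    refine (h1.congr_of_eventuallyEq (.of_forall fun s => ?_)).congr_deriv ?_
    · simp only [solitonPhase, id]; ring
    · ring
  simpa [solitonProfile] using hasDerivAt_logistic hθ h

lemma hasDerivAt_solitonProfile_y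
    (h : m * Real.exp (solitonPhase k l β x y t) + ε ≠ 0) :
    HasDerivAt (fun s => solitonProfile k l β m ε x s t)
      (-(k ^ 2 - l ^ 2) * (solitonProfile k l β m ε x y t
        - ε * solitonProfile k l β m ε x y t ^ 2)) y := by
  have hθ : HasDerivAt (fun s => solitonPhase k l β x s t) (k ^ 2 - l ^ 2) y := by
    have h1 := (((hasDerivAt_id y).const_mul (k ^ 2 - l ^ 2)).add_const
      (k * x - 4 * k ^ 3 * t + l * x - 4 * l ^ 3 * t - 2 * β t))
    refine (h1.congr_of_eventuallyEq (.of_forall fun s => ?_)).congr_deriv ?_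
    · simp only [solitonPhase, id]; ring
    · ring
  simpa [solitonProfile] using hasDerivAt_logistic hθ h

lemma hasDerivAt_solitonProfile_t {β' : ℝ} (hβ : HasDerivAt β β' t)
    (h : m * Real.exp (solitonPhase k l β x y t) + ε ≠ 0) :
    HasDerivAt (fun s => solitonProfile k l β m ε x y s)
      ((4 * (k ^ 3 + l ^ 3) + 2 * β') * (solitonProfile k l β m ε x y t
        - ε * solitonProfile k l β m ε x y t ^ 2)) t := by
  have hθ : HasDerivAt (fun s => solitonPhase k l β x y s)
      (-(4 * (k ^ 3 + l ^ 3) + 2 * β')) t := by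
    have h1 := (((hasDerivAt_id t).const_mul (-(4 * (k ^ 3 + l ^ 3)))).add_const
      (k * x + k ^ 2 * y + l * x - l ^ 2 * y)).sub (hβ.const_mul 2)
    refine (h1.congr_of_eventuallyEq (.of_forall fun s => ?_)).congr_deriv ?_
    · simp only [solitonPhase, id, Pi.sub_apply]; ring
    · ring
  simpa only [solitonProfile, Complex.ofReal_neg, neg_neg, Complex.ofReal_add, Complex.ofReal_mul,
    Complex.ofReal_pow, Complex.ofReal_ofNat] using hasDerivAt_logistic hθ h

lemma smooth3On_solitonProfile {Ω : Set (ℝ × ℝ × ℝ)} (hβ : ContDiff ℝ (⊤ : ℕ∞) β)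
    (h : ∀ x y t, (x, y, t) ∈ Ω → m * Real.exp (solitonPhase k l β x y t) + ε ≠ 0) :
    Smooth3On Ω (solitonProfile k l β m ε) := by
  refine Complex.ofRealCLM.contDiff.comp_contDiffOn (ContDiffOn.inv ?_ fun p hp => h _ _ _ hp)
  unfold solitonPhase
  fun_prop

end Profile

/-- A complex exponential factor with real phase of constant speed. -/
lemma hasDerivAt_const_mul_exp {θ : ℝ → ℝ} {θ' x : ℝ} (hθ : HasDerivAt θ θ' x) (a : ℂ) :
    HasDerivAt (fun s => a * ((Real.exp (θ s) : ℝ) : ℂ))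
      (θ' * (a * ((Real.exp (θ x) : ℝ) : ℂ))) x := by
  refine (hθ.exp.ofReal_comp.const_mul a).congr_deriv ?_
  push_cast
  ring

/-- **Example 3**: one-soliton solution of the mKPII equation with self-consistent
sources (`α = 1`) of degree 1, obtained by the generalized Darboux transformation
with `C(t) = e^{2β(t)}` applied to `u = 0`. -/
theorem mKPIIESCS_soliton_solution
    (k l : ℝ) (hkl : k + l ≠ 0)
    (β : ℝ → ℝ) (hβ : ContDiff ℝ (⊤ : ℕ∞) β)
    (c : ℝ → ℂ) (hc : ContDiff ℝ (⊤ : ℕ∞) c)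
    (hc2 : ∀ t, (c t) ^ 2 = ((2 * deriv β t : ℝ) : ℂ))
    (ξ₁ ξ₂ η : ℝ → ℝ → ℝ → ℝ)
    (hξ₁ : ξ₁ = fun (x y t : ℝ) => k * x + k ^ 2 * y - 4 * k ^ 3 * t)
    (hξ₂ : ξ₂ = fun (x y t : ℝ) => l * x - l ^ 2 * y - 4 * l ^ 3 * t)
    (hη : η = fun (x y t : ℝ) => (ξ₁ x y t + ξ₂ x y t) / 2 - β t)
    (Ω : Set (ℝ × ℝ × ℝ))
    (hΩ : Ω = {p : ℝ × ℝ × ℝ |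
      k / (k + l) * Real.exp (ξ₁ p.1 p.2.1 p.2.2 + ξ₂ p.1 p.2.1 p.2.2)
          - Real.exp (2 * β p.2.2) ≠ 0 ∧
      l / (k + l) * Real.exp (ξ₁ p.1 p.2.1 p.2.2 + ξ₂ p.1 p.2.1 p.2.2)
          + Real.exp (2 * β p.2.2) ≠ 0})
    (u : F3) (hu : u = fun (x y t : ℝ) =>
      ((-(k + l) / ((k / (k + l) * Real.exp (η x y t) - Real.exp (-η x y t))
          * (l / (k + l) * Real.exp (η x y t) + Real.exp (-η x y t))) : ℝ) : ℂ))
    (Ψ₁ : F3) (hΨ₁ : Ψ₁ = fun (x y t : ℝ) =>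
      -(c t / 2) * ((Real.exp (ξ₁ x y t + β t) : ℝ) : ℂ)
        / ((k / (k + l) * Real.exp (ξ₁ x y t + ξ₂ x y t)
            - Real.exp (2 * β t) : ℝ) : ℂ))
    (Φ₁ : F3) (hΦ₁ : Φ₁ = fun (x y t : ℝ) =>
      c t / 2 * ((Real.exp (ξ₂ x y t + β t) : ℝ) : ℂ)
        / ((l / (k + l) * Real.exp (ξ₁ x y t + ξ₂ x y t)
            + Real.exp (2 * β t) : ℝ) : ℂ))
    (w : F3) (hw : w = fun (x y t : ℝ) => ((k - l : ℝ) : ℂ) * u x y t) :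
    (∀ x y t, (x, y, t) ∈ Ω → px w x y t = py u x y t) ∧
    IsMKPESCSOn 1 Ω 1 u (fun _ => Ψ₁) (fun _ => Φ₁) w := by
  subst hξ₁ hξ₂ hη hw
  set K : ℂ := (k : ℂ) + l with hK
  set r := solitonProfile k l β (k / (k + l)) (-1) with hr
  set s := solitonProfile k l β (l / (k + l)) 1 with hs
  have hopen : IsOpen Ω := by
    have := hβ.continuous
    rw [hΩ]
    exact (isOpen_ne_fun (by fun_prop) (by fun_prop)).inter
      (isOpen_ne_fun (by fun_prop) (by fun_prop))
  have hexp : ∀ x y t, Real.exp ((k * x + k ^ 2 * y - 4 * k ^ 3 * t)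
      + (l * x - l ^ 2 * y - 4 * l ^ 3 * t))
      = Real.exp (solitonPhase k l β x y t) * Real.exp (2 * β t) := by
    intro x y t
    rw [← Real.exp_add, solitonPhase]
    ring_nf
  have hP : ∀ x y t, (x, y, t) ∈ Ω →
      k / (k + l) * Real.exp (solitonPhase k l β x y t) + -1 ≠ 0 := by
    intro x y t h h0
    rw [hΩ] at h
    refine h.1 ?_
    simp only [hexp]
    linear_combination Real.exp (2 * β t) * h0
  have hQ : ∀ x y t, (x, y, t) ∈ Ω →
      l / (k + l) * Real.exp (solitonPhase k l β x y t) + 1 ≠ 0 := by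
    intro x y t h h0
    rw [hΩ] at h
    refine h.2 ?_
    simp only [hexp]
    linear_combination Real.exp (2 * β t) * h0
  have hrel : ∀ x y t, (x, y, t) ∈ Ω →
      K * (r x y t * s x y t) = k * r x y t - l * s x y t := by
    intro x y t h
    have hp := hP x y t h
    have hq := hQ x y t h
    simp only [hr, hs, hK, solitonProfile]
    simp only [← Complex.ofReal_mul, ← Complex.ofReal_add, ← Complex.ofReal_sub]
    generalize Real.exp (solitonPhase k l β x y t) = z at hp hq
    rw [← mul_inv, ← div_eq_mul_inv, ← div_eq_mul_inv, ← div_eq_mul_inv, div_sub_div _ _ hp hq]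
    congr 1
    field_simp
    ring
  have hsum : ∀ x y t, (x, y, t) ∈ Ω →
      ((Real.exp (solitonPhase k l β x y t) : ℝ) : ℂ) * (r x y t * s x y t)
        = r x y t + s x y t := by
    intro x y t h
    have hp := hP x y t h
    have hq := hQ x y t h
    simp only [hr, hs, solitonProfile]
    simp only [← Complex.ofReal_mul, ← Complex.ofReal_add]
    generalize Real.exp (solitonPhase k l β x y t) = z at hp hq
    rw [← mul_inv, ← div_eq_mul_inv, ← one_div, ← one_div, div_add_div _ _ hp hq]
    congr 1
    field_simp
    ring
  have hu' : ∀ x y t, (x, y, t) ∈ Ω → u x y t = -K * (r x y t + s x y t) := by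
    intro x y t h
    rw [← hsum x y t h, hu]
    have hp := hP x y t h
    have hq := hQ x y t h
    simp only [hr, hs, hK, solitonProfile]
    simp only [← Complex.ofReal_mul, ← Complex.ofReal_add, ← Complex.ofReal_neg]
    set e := Real.exp (((k * x + k ^ 2 * y - 4 * k ^ 3 * t)
      + (l * x - l ^ 2 * y - 4 * l ^ 3 * t)) / 2 - β t) with he
    have he0 : e ≠ 0 := (Real.exp_pos _).ne'
    have hz : Real.exp (solitonPhase k l β x y t) = e * e := by
      rw [he, ← Real.exp_add, solitonPhase]
      ring_nf
    rw [Real.exp_neg, ← he]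
    rw [hz] at hp hq ⊢
    rw [show k / (k + l) * e - e⁻¹ = (k / (k + l) * (e * e) + -1) * e⁻¹ by field_simp; ring,
      show l / (k + l) * e + e⁻¹ = (l / (k + l) * (e * e) + 1) * e⁻¹ by field_simp]
    generalize k / (k + l) * (e * e) + -1 = p at *
    generalize l / (k + l) * (e * e) + 1 = q at *
    push_cast
    field_simp
  have hΨ' : ∀ x y t, (x, y, t) ∈ Ω → Ψ₁ x y t = -(c t / 2)
      * ((Real.exp (k * x + k ^ 2 * y - 4 * k ^ 3 * t - β t) : ℝ) : ℂ) * r x y t := by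
    intro x y t h
    have hp := hP x y t h
    have hden : k / (k + l) * Real.exp ((k * x + k ^ 2 * y - 4 * k ^ 3 * t)
        + (l * x - l ^ 2 * y - 4 * l ^ 3 * t)) - Real.exp (2 * β t)
        = (k / (k + l) * Real.exp (solitonPhase k l β x y t) + -1) * Real.exp (2 * β t) := by
      rw [hexp]; ring
    have hnum : Real.exp (k * x + k ^ 2 * y - 4 * k ^ 3 * t + β t)
        = Real.exp (k * x + k ^ 2 * y - 4 * k ^ 3 * t - β t) * Real.exp (2 * β t) := by
      rw [← Real.exp_add]; ring_nf
    simp only [hΨ₁, hden, hnum, hr, solitonProfile]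
    generalize k / (k + l) * Real.exp (solitonPhase k l β x y t) + -1 = p at *
    have hp' : (p : ℂ) ≠ 0 := by exact_mod_cast hp
    have hB : ((Real.exp (2 * β t) : ℝ) : ℂ) ≠ 0 := by exact_mod_cast (Real.exp_pos _).ne'
    rw [Complex.ofReal_mul, Complex.ofReal_mul, Complex.ofReal_inv]
    field_simp
  have hΦ' : ∀ x y t, (x, y, t) ∈ Ω → Φ₁ x y t = c t / 2
      * ((Real.exp (l * x - l ^ 2 * y - 4 * l ^ 3 * t - β t) : ℝ) : ℂ) * s x y t := by
    intro x y t h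
    have hp := hQ x y t h
    have hden : l / (k + l) * Real.exp ((k * x + k ^ 2 * y - 4 * k ^ 3 * t)
        + (l * x - l ^ 2 * y - 4 * l ^ 3 * t)) + Real.exp (2 * β t)
        = (l / (k + l) * Real.exp (solitonPhase k l β x y t) + 1) * Real.exp (2 * β t) := by
      rw [hexp]; ring
    have hnum : Real.exp (l * x - l ^ 2 * y - 4 * l ^ 3 * t + β t)
        = Real.exp (l * x - l ^ 2 * y - 4 * l ^ 3 * t - β t) * Real.exp (2 * β t) := by
      rw [← Real.exp_add]; ring_nf
    simp only [hΦ₁, hden, hnum, hs, solitonProfile]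
    generalize l / (k + l) * Real.exp (solitonPhase k l β x y t) + 1 = p at *
    have hp' : (p : ℂ) ≠ 0 := by exact_mod_cast hp
    have hB : ((Real.exp (2 * β t) : ℝ) : ℂ) ≠ 0 := by exact_mod_cast (Real.exp_pos _).ne'
    rw [Complex.ofReal_mul, Complex.ofReal_mul, Complex.ofReal_inv]
    field_simp
  have hΨΦ : ∀ x y t, (x, y, t) ∈ Ω → fmul Ψ₁ Φ₁ x y t
      = -((deriv β t : ℝ) : ℂ) / 2 * (r x y t + s x y t) := by
    intro x y t h
    have he : ((Real.exp (solitonPhase k l β x y t) : ℝ) : ℂ)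
        = ((Real.exp (k * x + k ^ 2 * y - 4 * k ^ 3 * t - β t) : ℝ) : ℂ)
          * ((Real.exp (l * x - l ^ 2 * y - 4 * l ^ 3 * t - β t) : ℝ) : ℂ) := by
      rw [← Complex.ofReal_mul, ← Real.exp_add, solitonPhase]
      ring_nf
    have hc2t := hc2 t
    push_cast at hc2t
    rw [fmul, hΨ' x y t h, hΦ' x y t h, ← hsum x y t h, he]
    generalize ((Real.exp (k * x + k ^ 2 * y - 4 * k ^ 3 * t - β t) : ℝ) : ℂ) = e₁
    generalize ((Real.exp (l * x - l ^ 2 * y - 4 * l ^ 3 * t - β t) : ℝ) : ℂ) = e₂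
    linear_combination -(e₁ * e₂ * r x y t * s x y t / 4) * hc2t
  have hrx : ∀ x y t, (x, y, t) ∈ Ω → HasDerivAt (fun z => r z y t)
      (-K * (r x y t + r x y t ^ 2)) x := fun x y t h =>
    (hasDerivAt_solitonProfile_x (hP x y t h)).congr_deriv (by rw [hK]; push_cast; ring)
  have hsx : ∀ x y t, (x, y, t) ∈ Ω → HasDerivAt (fun z => s z y t)
      (-K * (s x y t - s x y t ^ 2)) x := fun x y t h =>
    (hasDerivAt_solitonProfile_x (hQ x y t h)).congr_deriv (by rw [hK]; push_cast; ring)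
  have hry : ∀ x y t, (x, y, t) ∈ Ω → HasDerivAt (fun z => r x z t)
      (-(k ^ 2 - l ^ 2) * (r x y t + r x y t ^ 2)) y := fun x y t h => by
    simpa using hasDerivAt_solitonProfile_y (hP x y t h)
  have hsy : ∀ x y t, (x, y, t) ∈ Ω → HasDerivAt (fun z => s x z t)
      (-(k ^ 2 - l ^ 2) * (s x y t - s x y t ^ 2)) y := fun x y t h => by
    simpa using hasDerivAt_solitonProfile_y (hQ x y t h)
  have hβt : ∀ t, HasDerivAt β (deriv β t) t := fun t =>
    (hβ.differentiable (by simp) t).hasDerivAt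
  have hrt : ∀ x y t, (x, y, t) ∈ Ω → HasDerivAt (fun z => r x y z)
      ((4 * (k ^ 3 + l ^ 3) + 2 * (deriv β t : ℝ)) * (r x y t + r x y t ^ 2)) t :=
    fun x y t h => by
      simpa using hasDerivAt_solitonProfile_t (hβt t) (hP x y t h)
  have hst : ∀ x y t, (x, y, t) ∈ Ω → HasDerivAt (fun z => s x y z)
      ((4 * (k ^ 3 + l ^ 3) + 2 * (deriv β t : ℝ)) * (s x y t - s x y t ^ 2)) t :=
    fun x y t h => by
      simpa using hasDerivAt_solitonProfile_t (hβt t) (hQ x y t h)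
  have hux : ∀ x y t, (x, y, t) ∈ Ω → px u x y t
      = K ^ 2 * (r x y t + r x y t ^ 2 + (s x y t - s x y t ^ 2)) := by
    intro x y t h
    refine px_eq_of_eqOn hopen hu' h ?_
    refine HasDerivAt.congr_deriv
      (((hrx x y t h).add (hsx x y t h)).const_mul (-K)) ?_
    ring
  have huxx : ∀ x y t, (x, y, t) ∈ Ω → px (px u) x y t
      = -K ^ 3 * (r x y t + 3 * r x y t ^ 2 + 2 * r x y t ^ 3
        + (s x y t - 3 * s x y t ^ 2 + 2 * s x y t ^ 3)) := by
    intro x y t h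
    refine px_eq_of_eqOn hopen hux h ?_
    have hr1 := hrx x y t h
    have hs1 := hsx x y t h
    refine HasDerivAt.congr_deriv
      (((hr1.add (hr1.pow 2)).add (hs1.sub (hs1.pow 2))).const_mul (K ^ 2)) ?_
    push_cast
    ring
  have huxxx : ∀ x y t, (x, y, t) ∈ Ω → px (px (px u)) x y t
      = K ^ 4 * ((r x y t + r x y t ^ 2) * (1 + 6 * r x y t + 6 * r x y t ^ 2)
        + (s x y t - s x y t ^ 2) * (1 - 6 * s x y t + 6 * s x y t ^ 2)) := by
    intro x y t h
    refine px_eq_of_eqOn hopen huxx h ?_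
    have hr1 := hrx x y t h
    have hs1 := hsx x y t h
    refine HasDerivAt.congr_deriv
      ((((hr1.add ((hr1.pow 2).const_mul 3)).add ((hr1.pow 3).const_mul 2)).add
      ((hs1.sub ((hs1.pow 2).const_mul 3)).add ((hs1.pow 3).const_mul 2))).const_mul (-K ^ 3)) ?_
    push_cast
    ring
  have huy : ∀ x y t, (x, y, t) ∈ Ω → py u x y t
      = K * (k ^ 2 - l ^ 2) * (r x y t + r x y t ^ 2 + (s x y t - s x y t ^ 2)) := by
    intro x y t h
    refine py_eq_of_eqOn hopen hu' h ?_
    refine HasDerivAt.congr_deriv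
      (((hry x y t h).add (hsy x y t h)).const_mul (-K)) ?_
    ring
  have hut : ∀ x y t, (x, y, t) ∈ Ω → pt u x y t
      = -K * (4 * (k ^ 3 + l ^ 3) + 2 * (deriv β t : ℝ))
        * (r x y t + r x y t ^ 2 + (s x y t - s x y t ^ 2)) := by
    intro x y t h
    refine pt_eq_of_eqOn hopen hu' h ?_
    refine HasDerivAt.congr_deriv
      (((hrt x y t h).add (hst x y t h)).const_mul (-K)) ?_
    ring
  have hw' : ∀ x y t, (x, y, t) ∈ Ω → ((k - l : ℝ) : ℂ) * u x y t
      = ((k - l : ℝ) : ℂ) * (-K * (r x y t + s x y t)) := fun x y t h => by rw [hu' x y t h]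
  have hwx : ∀ x y t, (x, y, t) ∈ Ω → px (fun x y t => ((k - l : ℝ) : ℂ) * u x y t) x y t
      = py u x y t := by
    intro x y t h
    rw [huy x y t h]
    refine px_eq_of_eqOn hopen hw' h ?_
    refine HasDerivAt.congr_deriv
      ((((hrx x y t h).add (hsx x y t h)).const_mul (-K)).const_mul
      ((k - l : ℝ) : ℂ)) ?_
    push_cast
    ring
  have hwy : ∀ x y t, (x, y, t) ∈ Ω → py (fun x y t => ((k - l : ℝ) : ℂ) * u x y t) x y t
      = (k - l) * (K * (k ^ 2 - l ^ 2)
        * (r x y t + r x y t ^ 2 + (s x y t - s x y t ^ 2))) := by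
    intro x y t h
    refine py_eq_of_eqOn hopen hw' h ?_
    refine HasDerivAt.congr_deriv
      ((((hry x y t h).add (hsy x y t h)).const_mul (-K)).const_mul
      ((k - l : ℝ) : ℂ)) ?_
    push_cast
    ring
  have hΨΦx : ∀ x y t, (x, y, t) ∈ Ω → px (fmul Ψ₁ Φ₁) x y t
      = ((deriv β t : ℝ) : ℂ) / 2 * K
        * (r x y t + r x y t ^ 2 + (s x y t - s x y t ^ 2)) := by
    intro x y t h
    refine px_eq_of_eqOn hopen hΨΦ h ?_
    refine HasDerivAt.congr_deriv
      (((hrx x y t h).add (hsx x y t h)).const_mul (-((deriv β t : ℝ) : ℂ) / 2)) ?_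
    ring
  set e₁ : F3 := fun x y t => -(c t / 2)
      * ((Real.exp (k * x + k ^ 2 * y - 4 * k ^ 3 * t - β t) : ℝ) : ℂ) with he₁
  set e₂ : F3 := fun x y t => c t / 2
      * ((Real.exp (l * x - l ^ 2 * y - 4 * l ^ 3 * t - β t) : ℝ) : ℂ) with he₂
  have he₁x : ∀ x y t, HasDerivAt (fun z => e₁ z y t) (k * e₁ x y t) x := fun x y t =>
    hasDerivAt_const_mul_exp (by
      simpa using ((((hasDerivAt_id x).const_mul k).add_const (k ^ 2 * y)).sub_const
        (4 * k ^ 3 * t)).sub_const (β t)) _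
  have he₁y : ∀ x y t, HasDerivAt (fun z => e₁ x z t) (k ^ 2 * e₁ x y t) y := fun x y t =>
    (hasDerivAt_const_mul_exp (θ' := k ^ 2)
      (θ := fun z => k * x + k ^ 2 * z - 4 * k ^ 3 * t - β t) (by
      simpa using ((((hasDerivAt_id y).const_mul (k ^ 2)).const_add (k * x)).sub_const
        (4 * k ^ 3 * t)).sub_const (β t)) (-(c t / 2))).congr_deriv (by simp [he₁])
  have he₂x : ∀ x y t, HasDerivAt (fun z => e₂ z y t) (l * e₂ x y t) x := fun x y t =>
    hasDerivAt_const_mul_exp (by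
      simpa using ((((hasDerivAt_id x).const_mul l).sub_const (l ^ 2 * y)).sub_const
        (4 * l ^ 3 * t)).sub_const (β t)) _
  have he₂y : ∀ x y t, HasDerivAt (fun z => e₂ x z t) (-l ^ 2 * e₂ x y t) y := fun x y t =>
    (hasDerivAt_const_mul_exp (θ' := -l ^ 2)
      (θ := fun z => l * x - l ^ 2 * z - 4 * l ^ 3 * t - β t) (by
      simpa using ((((hasDerivAt_id y).const_mul (l ^ 2)).const_sub (l * x)).sub_const
        (4 * l ^ 3 * t)).sub_const (β t)) (c t / 2)).congr_deriv (by simp [he₂])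
  have hΨx : ∀ x y t, (x, y, t) ∈ Ω → px Ψ₁ x y t
      = e₁ x y t * (k * r x y t - K * (r x y t + r x y t ^ 2)) := by
    intro x y t h
    refine px_eq_of_eqOn hopen hΨ' h ?_
    refine HasDerivAt.congr_deriv
      ((he₁x x y t).mul (hrx x y t h)) ?_
    ring
  have hΨxx : ∀ x y t, (x, y, t) ∈ Ω → px (px Ψ₁) x y t
      = e₁ x y t * (k ^ 2 * r x y t - 2 * k * K * (r x y t + r x y t ^ 2)
        + K ^ 2 * (r x y t + r x y t ^ 2) * (1 + 2 * r x y t)) := by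
    intro x y t h
    refine px_eq_of_eqOn hopen hΨx h ?_
    have hr1 := hrx x y t h
    refine HasDerivAt.congr_deriv
      ((he₁x x y t).mul
      ((hr1.const_mul (k : ℂ)).sub ((hr1.add (hr1.pow 2)).const_mul K))) ?_
    push_cast
    ring
  have hΨy : ∀ x y t, (x, y, t) ∈ Ω → py Ψ₁ x y t
      = e₁ x y t * (k ^ 2 * r x y t - (k ^ 2 - l ^ 2) * (r x y t + r x y t ^ 2)) := by
    intro x y t h
    refine py_eq_of_eqOn hopen hΨ' h ?_
    refine HasDerivAt.congr_deriv
      ((he₁y x y t).mul (hry x y t h)) ?_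
    ring
  have hΦx : ∀ x y t, (x, y, t) ∈ Ω → px Φ₁ x y t
      = e₂ x y t * (l * s x y t - K * (s x y t - s x y t ^ 2)) := by
    intro x y t h
    refine px_eq_of_eqOn hopen hΦ' h ?_
    refine HasDerivAt.congr_deriv
      ((he₂x x y t).mul (hsx x y t h)) ?_
    ring
  have hΦxx : ∀ x y t, (x, y, t) ∈ Ω → px (px Φ₁) x y t
      = e₂ x y t * (l ^ 2 * s x y t - 2 * l * K * (s x y t - s x y t ^ 2)
        + K ^ 2 * (s x y t - s x y t ^ 2) * (1 - 2 * s x y t)) := by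
    intro x y t h
    refine px_eq_of_eqOn hopen hΦx h ?_
    have hs1 := hsx x y t h
    refine HasDerivAt.congr_deriv
      ((he₂x x y t).mul
      ((hs1.const_mul (l : ℂ)).sub ((hs1.sub (hs1.pow 2)).const_mul K))) ?_
    push_cast
    ring
  have hΦy : ∀ x y t, (x, y, t) ∈ Ω → py Φ₁ x y t
      = e₂ x y t * (-l ^ 2 * s x y t - (k ^ 2 - l ^ 2) * (s x y t - s x y t ^ 2)) := by
    intro x y t h
    refine py_eq_of_eqOn hopen hΦ' h ?_
    refine HasDerivAt.congr_deriv
      ((he₂y x y t).mul (hsy x y t h)) ?_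
    ring
  have hrS : Smooth3On Ω r := smooth3On_solitonProfile hβ hP
  have hsS : Smooth3On Ω s := smooth3On_solitonProfile hβ hQ
  have huS : Smooth3On Ω u := Smooth3On.congr (g := fun x y t => -K * (r x y t + s x y t))
    (contDiffOn_const.mul (hrS.add hsS)) hu'
  have hc1 : ContDiff ℝ (⊤ : ℕ∞) fun p : ℝ × ℝ × ℝ => c p.2.2 / 2 :=
    (hc.comp (contDiff_snd.comp contDiff_snd)).div_const 2
  have he₁S : Smooth3On Ω e₁ := by
    refine (hc1.neg.mul (Complex.ofRealCLM.contDiff.comp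
      (ContDiff.exp ?_))).contDiffOn
    fun_prop
  have he₂S : Smooth3On Ω e₂ := by
    refine (hc1.mul (Complex.ofRealCLM.contDiff.comp
      (ContDiff.exp ?_))).contDiffOn
    fun_prop
  refine ⟨hwx, huS, contDiffOn_const.mul huS,
    fun _ => Smooth3On.congr (g := fun x y t => e₁ x y t * r x y t) (he₁S.mul hrS) hΨ',
    fun _ => Smooth3On.congr (g := fun x y t => e₂ x y t * s x y t) (he₂S.mul hsS) hΦ',
    hwx, ?_, fun _ => ?_, fun _ => ?_⟩
  · intro x y t h
    simp only [Finset.univ_unique, Finset.sum_singleton]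
    rw [hut x y t h, huxxx x y t h, hwy x y t h, hux x y t h, hu' x y t h, hΨΦx x y t h]
    push_cast
    linear_combination (-12 * K ^ 3
      * (r x y t + r x y t ^ 2 + (s x y t - s x y t ^ 2))) * hrel x y t h
  · intro x y t h
    rw [hΨy x y t h, hΨxx x y t h, hΨx x y t h, hu' x y t h]
    linear_combination (2 * K * r x y t * e₁ x y t) * hrel x y t h
  · intro x y t h
    rw [hΦy x y t h, hΦxx x y t h, hΦx x y t h, hu' x y t h]
    linear_combination (-2 * K * s x y t * e₂ x y t) * hrel x y t h

end
end

section
/- Let μ, ν ∈ ℝ with ν ≠ 0, let β : ℝ → ℝ be C^∞, and let c : ℝ → ℂ be C^∞ with c(t)² = dβ/dt. Set θ = −iμx + i(μ² − ν²)y − 4i(μ³ − 3μν²)t, η = −νx + 2μνy + 4ν(ν² − 3μ²)t, and f = η − β(t). Let Ω ⊆ ℝ³ be the open set where (iν − μ) e^{2η} + 2ν e^{2β(t)} ≠ 0 and (iν + μ) e^{2η} − 2ν e^{2β(t)} ≠ 0. Define on Ω: u = 2νi/[(1/4) e^{2f} + (e^{−f} − (μ/(2ν)) e^{f})²], Ψ₁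 = ν(1−i) c(t) e^{β(t) + θ + η}/[(iν − μ) e^{2η} + 2ν e^{2β(t)}], Φ₁ = −ν(1−i) c(t) e^{β(t) − θ + η}/[(iν + μ) e^{2η} − 2ν e^{2β(t)}], and w = −2μ u. Then w_x = u_y and (u, Ψ₁, Φ₁, w) is a solution on Ω of the mKPIESCS (α = i) of degree 1. (One-soliton solution of the mKPI equation with self-consistent sources, Example 4, obtained by the generalized Darboux transformation with C(t) = i e^{2β(t)} applied to u = 0 with f₁ = e^{θ+η}, g₁ = e^{−θ+η}.) -/
noncomputable section

/-- Logistic equation for `m / (p a + m)` when `a` has logarithmic derivative `κ`. -/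
theorem hasDerivAt_logistic_s18 {a : ℝ → ℂ} {κ p m : ℂ} {x : ℝ}
    (ha : HasDerivAt a (κ * a x) x) (h : p * a x + m ≠ 0) :
    HasDerivAt (fun s => m / (p * a s + m))
      (-(κ * (m / (p * a x + m)) * (1 - m / (p * a x + m)))) x := by
  refine ((hasDerivAt_const x m).div ((ha.const_mul p).add_const m) h).congr_deriv ?_
  field_simp
  ring

/-- If `S`, `T` solve logistic equations and are linked by the rational relation
`(iν - μ) S + (iν + μ) T = 2iν S T`, then `u = -2ν (S - T)` together with
`P = e S` and `Q = e' T` solves the mKPI equation with a self-consistent source. -/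
theorem logistic_pair_solution {μ ν : ℂ} {b : ℝ → ℂ} {S T e e' u P Q w : F3}
    (hSx : ∀ x y t, HasDerivAt (fun s => S s y t)
      (-(-2 * ν * S x y t * (1 - S x y t))) x)
    (hSy : ∀ x y t, HasDerivAt (fun s => S x s t)
      (-(4 * μ * ν * S x y t * (1 - S x y t))) y)
    (hSt : ∀ x y t, HasDerivAt (fun s => S x y s)
      (-((8 * ν * (ν ^ 2 - 3 * μ ^ 2) - 2 * b t) * S x y t * (1 - S x y t))) t)
    (hTx : ∀ x y t, HasDerivAt (fun s => T s y t)
      (-(-2 * ν * T x y t * (1 - T x y t))) x)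
    (hTy : ∀ x y t, HasDerivAt (fun s => T x s t)
      (-(4 * μ * ν * T x y t * (1 - T x y t))) y)
    (hTt : ∀ x y t, HasDerivAt (fun s => T x y s)
      (-((8 * ν * (ν ^ 2 - 3 * μ ^ 2) - 2 * b t) * T x y t * (1 - T x y t))) t)
    (hex : ∀ x y t, HasDerivAt (fun s => e s y t)
      ((-ν - Complex.I * μ) * e x y t) x)
    (hey : ∀ x y t, HasDerivAt (fun s => e x s t)
      ((2 * μ * ν + Complex.I * (μ ^ 2 - ν ^ 2)) * e x y t) y)
    (hex' : ∀ x y t, HasDerivAt (fun s => e' s y t)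
      ((-ν + Complex.I * μ) * e' x y t) x)
    (hey' : ∀ x y t, HasDerivAt (fun s => e' x s t)
      ((2 * μ * ν - Complex.I * (μ ^ 2 - ν ^ 2)) * e' x y t) y)
    (hrel : ∀ x y t, (Complex.I * ν - μ) * S x y t + (Complex.I * ν + μ) * T x y t
      = 2 * Complex.I * ν * S x y t * T x y t)
    (hu : ∀ x y t, u x y t = -2 * ν * (S x y t - T x y t))
    (hP : ∀ x y t, P x y t = e x y t * S x y t)
    (hQ : ∀ x y t, Q x y t = e' x y t * T x y t)
    (hPQ : ∀ x y t, P x y t * Q x y t = b t * (S x y t - T x y t) / 2)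
    (hw : ∀ x y t, w x y t = -2 * μ * u x y t) (x y t : ℝ) :
    px w x y t = py u x y t ∧
    pt u x y t + px (px (px u)) x y t + 3 * Complex.I ^ 2 * py w x y t
      - 6 * Complex.I * w x y t * px u x y t - 6 * (u x y t) ^ 2 * px u x y t
      + 4 * px (fmul P Q) x y t = 0 ∧
    Complex.I * py P x y t = px (px P) x y t - 2 * u x y t * px P x y t ∧
    Complex.I * py Q x y t = -(px (px Q) x y t) - 2 * u x y t * px Q x y t := by
  have hI : Complex.I ^ 2 = -1 := Complex.I_sq
  obtain rfl : u = fun x y t => -2 * ν * (S x y t - T x y t) := by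
    funext x y t; exact hu x y t
  obtain rfl : w = fun x y t => -2 * μ * (-2 * ν * (S x y t - T x y t)) := by
    funext x y t; exact hw x y t
  have hfPQ : fmul P Q = fun x y t => b t * (S x y t - T x y t) / 2 := by
    funext x y t; exact hPQ x y t
  obtain rfl : P = fun x y t => e x y t * S x y t := by
    funext x y t; exact hP x y t
  obtain rfl : Q = fun x y t => e' x y t * T x y t := by
    funext x y t; exact hQ x y t
  clear hu hw hP hQ hPQ
  have hux : px (fun x y t => -2 * ν * (S x y t - T x y t)) = fun x y t =>
      -4 * ν ^ 2 * (S x y t - S x y t ^ 2 - T x y t + T x y t ^ 2) := by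
    funext x y t
    refine ((((hSx x y t).sub (hTx x y t)).const_mul (-2 * ν)).congr_deriv ?_).deriv
    ring
  have huxx : px (px (fun x y t => -2 * ν * (S x y t - T x y t))) = fun x y t =>
      -8 * ν ^ 3 * (S x y t - 3 * S x y t ^ 2 + 2 * S x y t ^ 3
        - T x y t + 3 * T x y t ^ 2 - 2 * T x y t ^ 3) := by
    rw [hux]
    funext x y t
    refine (((((hSx x y t).sub ((hSx x y t).pow 2)).sub (hTx x y t)).add
      ((hTx x y t).pow 2)).const_mul (-4 * ν ^ 2) |>.congr_deriv ?_).deriv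
    push_cast
    ring
  have huxxx : px (px (px (fun x y t => -2 * ν * (S x y t - T x y t)))) = fun x y t =>
      -16 * ν ^ 4 * (S x y t * (1 - S x y t) * (1 - 6 * S x y t + 6 * S x y t ^ 2)
        - T x y t * (1 - T x y t) * (1 - 6 * T x y t + 6 * T x y t ^ 2)) := by
    rw [huxx]
    funext x y t
    refine (((((((hSx x y t).sub (((hSx x y t).pow 2).const_mul 3)).add
      (((hSx x y t).pow 3).const_mul 2)).sub (hTx x y t)).add
      (((hTx x y t).pow 2).const_mul 3)).sub (((hTx x y t).pow 3).const_mul 2)).const_mul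
      (-8 * ν ^ 3) |>.congr_deriv ?_).deriv
    push_cast
    ring
  have huy : py (fun x y t => -2 * ν * (S x y t - T x y t)) x y t =
      8 * μ * ν ^ 2 * (S x y t - S x y t ^ 2 - T x y t + T x y t ^ 2) := by
    refine ((((hSy x y t).sub (hTy x y t)).const_mul (-2 * ν)).congr_deriv ?_).deriv
    ring
  have hut : pt (fun x y t => -2 * ν * (S x y t - T x y t)) x y t =
      2 * ν * (8 * ν * (ν ^ 2 - 3 * μ ^ 2) - 2 * b t)
        * (S x y t - S x y t ^ 2 - T x y t + T x y t ^ 2) := by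
    refine ((((hSt x y t).sub (hTt x y t)).const_mul (-2 * ν)).congr_deriv ?_).deriv
    ring
  have hwx : px (fun x y t => -2 * μ * (-2 * ν * (S x y t - T x y t))) x y t =
      8 * μ * ν ^ 2 * (S x y t - S x y t ^ 2 - T x y t + T x y t ^ 2) := by
    refine (((((hSx x y t).sub (hTx x y t)).const_mul (-2 * ν)).const_mul
      (-2 * μ)).congr_deriv ?_).deriv
    ring
  have hwy : py (fun x y t => -2 * μ * (-2 * ν * (S x y t - T x y t))) x y t =
      -16 * μ ^ 2 * ν ^ 2 * (S x y t - S x y t ^ 2 - T x y t + T x y t ^ 2) := by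
    refine (((((hSy x y t).sub (hTy x y t)).const_mul (-2 * ν)).const_mul
      (-2 * μ)).congr_deriv ?_).deriv
    ring
  have hPQx : px (fun x y t => b t * (S x y t - T x y t) / 2) x y t =
      b t * ν * (S x y t - S x y t ^ 2 - T x y t + T x y t ^ 2) := by
    refine (((((hSx x y t).sub (hTx x y t)).const_mul (b t)).div_const 2).congr_deriv ?_).deriv
    ring
  have hPx : px (fun x y t => e x y t * S x y t) = fun x y t =>
      e x y t * ((ν - Complex.I * μ) * S x y t - 2 * ν * S x y t ^ 2) := by
    funext x y t
    refine (((hex x y t).mul (hSx x y t)).congr_deriv ?_).deriv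
    ring
  have hPxx : px (px (fun x y t => e x y t * S x y t)) x y t =
      e x y t * ((-ν - Complex.I * μ) * ((ν - Complex.I * μ) * S x y t - 2 * ν * S x y t ^ 2)
        + ((ν - Complex.I * μ) - 4 * ν * S x y t) * (2 * ν * S x y t * (1 - S x y t))) := by
    rw [hPx]
    refine (((hex x y t).mul (((hSx x y t).const_mul (ν - Complex.I * μ)).sub
      (((hSx x y t).pow 2).const_mul (2 * ν)))).congr_deriv ?_).deriv
    simp only [Pi.sub_apply, Pi.pow_apply]
    push_cast
    ring
  have hPy : py (fun x y t => e x y t * S x y t) x y t =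
      e x y t * ((2 * μ * ν + Complex.I * (μ ^ 2 - ν ^ 2)) * S x y t
        - 4 * μ * ν * S x y t * (1 - S x y t)) := by
    refine (((hey x y t).mul (hSy x y t)).congr_deriv ?_).deriv
    ring
  have hQx : px (fun x y t => e' x y t * T x y t) = fun x y t =>
      e' x y t * ((ν + Complex.I * μ) * T x y t - 2 * ν * T x y t ^ 2) := by
    funext x y t
    refine (((hex' x y t).mul (hTx x y t)).congr_deriv ?_).deriv
    ring
  have hQxx : px (px (fun x y t => e' x y t * T x y t)) x y t =
      e' x y t * ((-ν + Complex.I * μ) * ((ν + Complex.I * μ) * T x y t - 2 * ν * T x y t ^ 2)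
        + ((ν + Complex.I * μ) - 4 * ν * T x y t) * (2 * ν * T x y t * (1 - T x y t))) := by
    rw [hQx]
    refine (((hex' x y t).mul (((hTx x y t).const_mul (ν + Complex.I * μ)).sub
      (((hTx x y t).pow 2).const_mul (2 * ν)))).congr_deriv ?_).deriv
    simp only [Pi.sub_apply, Pi.pow_apply]
    push_cast
    ring
  have hQy : py (fun x y t => e' x y t * T x y t) x y t =
      e' x y t * ((2 * μ * ν - Complex.I * (μ ^ 2 - ν ^ 2)) * T x y t
        - 4 * μ * ν * T x y t * (1 - T x y t)) := by
    refine (((hey' x y t).mul (hTy x y t)).congr_deriv ?_).deriv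
    ring
  have hr := hrel x y t
  rw [hwx, huy, hut, huxxx, hux, hwy, hfPQ, hPQx, hPxx, hPy, hPx, hQxx, hQy, hQx]
  beta_reduce
  generalize S x y t = s at *
  generalize T x y t = r at *
  generalize Complex.I = i at *
  refine ⟨rfl, ?_, ?_, ?_⟩
  · clear * - hr hI
    grind
  · generalize e x y t = k
    clear * - hr hI
    grind
  · generalize e' x y t = k
    clear * - hr hI
    grind

/-- **Example 4**: one-soliton solution of the mKPI equation with self-consistent
sources (`α = i`) of degree 1, obtained by the generalized Darboux transformation
with `C(t) = i e^{2β(t)}` applied to `u = 0` with `f₁ = e^{θ+η}`, `g₁ = e^{-θ+η}`. -/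
theorem mKPIESCS_soliton_solution
    (μ ν : ℝ) (hν : ν ≠ 0)
    (β : ℝ → ℝ) (hβ : ContDiff ℝ (⊤ : ℕ∞) β)
    (c : ℝ → ℂ) (hc : ContDiff ℝ (⊤ : ℕ∞) c)
    (hc2 : ∀ t, (c t) ^ 2 = ((deriv β t : ℝ) : ℂ))
    (θ : F3)
    (hθ : θ = fun (x y t : ℝ) =>
      -(Complex.I * (μ : ℂ) * (x : ℂ)) + Complex.I * ((μ ^ 2 - ν ^ 2 : ℝ) : ℂ) * (y : ℂ)
        - 4 * Complex.I * ((μ ^ 3 - 3 * μ * ν ^ 2 : ℝ) : ℂ) * (t : ℂ))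
    (η : ℝ → ℝ → ℝ → ℝ)
    (hη : η = fun (x y t : ℝ) =>
      -(ν * x) + 2 * μ * ν * y + 4 * ν * (ν ^ 2 - 3 * μ ^ 2) * t)
    (f : ℝ → ℝ → ℝ → ℝ) (hf : f = fun (x y t : ℝ) => η x y t - β t)
    (Ω : Set (ℝ × ℝ × ℝ))
    (hΩ : Ω = {p : ℝ × ℝ × ℝ |
      (Complex.I * (ν : ℂ) - (μ : ℂ)) * ((Real.exp (2 * η p.1 p.2.1 p.2.2) : ℝ) : ℂ)
          + 2 * (ν : ℂ) * ((Real.exp (2 * β p.2.2) : ℝ) : ℂ) ≠ 0 ∧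
      (Complex.I * (ν : ℂ) + (μ : ℂ)) * ((Real.exp (2 * η p.1 p.2.1 p.2.2) : ℝ) : ℂ)
          - 2 * (ν : ℂ) * ((Real.exp (2 * β p.2.2) : ℝ) : ℂ) ≠ 0})
    (u : F3) (hu : u = fun (x y t : ℝ) =>
      2 * (ν : ℂ) * Complex.I
        / ((1 / 4 * Real.exp (2 * f x y t)
            + (Real.exp (-f x y t) - μ / (2 * ν) * Real.exp (f x y t)) ^ 2 : ℝ) : ℂ))
    (Ψ₁ : F3) (hΨ₁ : Ψ₁ = fun (x y t : ℝ) =>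
      (ν : ℂ) * (1 - Complex.I) * c t
          * Complex.exp (((β t + η x y t : ℝ) : ℂ) + θ x y t)
        / ((Complex.I * (ν : ℂ) - (μ : ℂ)) * ((Real.exp (2 * η x y t) : ℝ) : ℂ)
            + 2 * (ν : ℂ) * ((Real.exp (2 * β t) : ℝ) : ℂ)))
    (Φ₁ : F3) (hΦ₁ : Φ₁ = fun (x y t : ℝ) =>
      -((ν : ℂ) * (1 - Complex.I) * c t
          * Complex.exp (((β t + η x y t : ℝ) : ℂ) - θ x y t))
        / ((Complex.I * (ν : ℂ) + (μ : ℂ)) * ((Real.exp (2 * η x y t) : ℝ) : ℂ)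
            - 2 * (ν : ℂ) * ((Real.exp (2 * β t) : ℝ) : ℂ)))
    (w : F3) (hw : w = fun (x y t : ℝ) => -2 * (μ : ℂ) * u x y t) :
    (∀ x y t, (x, y, t) ∈ Ω → px w x y t = py u x y t) ∧
    IsMKPESCSOn Complex.I Ω 1 u (fun _ => Ψ₁) (fun _ => Φ₁) w := by
  have hνC : (ν : ℂ) ≠ 0 := by exact_mod_cast hν
  have hI : Complex.I ^ 2 = -1 := Complex.I_sq
  obtain ⟨a, ha⟩ : ∃ a : F3, a = fun x y t =>
      Complex.exp (((2 * (η x y t - β t) : ℝ) : ℂ)) := ⟨_, rfl⟩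
  have hD (x y t : ℝ) : (Complex.I * ν - μ) * a x y t + 2 * ν ≠ 0 ∧
      (Complex.I * ν + μ) * a x y t + -(2 * ν) ≠ 0 := by
    have ha' : a x y t = ((Real.exp (2 * (η x y t - β t)) : ℝ) : ℂ) := by
      rw [ha, Complex.ofReal_exp]
    have hpos := (Real.exp_pos (2 * (η x y t - β t))).ne'
    rw [ha']
    generalize Real.exp (2 * (η x y t - β t)) = r at *
    constructor <;> intro h <;> replace h := congrArg Complex.im h <;>
      simp [hν, hpos] at h
  obtain ⟨S, hS⟩ : ∃ S : F3, S = fun x y t =>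
      2 * ν / ((Complex.I * ν - μ) * a x y t + 2 * ν) := ⟨_, rfl⟩
  obtain ⟨T, hT⟩ : ∃ T : F3, T = fun x y t =>
      -(2 * ν) / ((Complex.I * ν + μ) * a x y t + -(2 * ν)) := ⟨_, rfl⟩
  obtain ⟨e, he⟩ : ∃ e : F3, e = fun x y t =>
      (1 - Complex.I) / 2 * c t * Complex.exp (((η x y t - β t : ℝ) : ℂ) + θ x y t) :=
    ⟨_, rfl⟩
  obtain ⟨e', he'⟩ : ∃ e' : F3, e' = fun x y t =>
      (1 - Complex.I) / 2 * c t * Complex.exp (((η x y t - β t : ℝ) : ℂ) - θ x y t) :=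
    ⟨_, rfl⟩
  have hηx (x y t : ℝ) : HasDerivAt (fun s => η s y t - β t) (-ν) x := by
    rw [hη]
    refine HasDerivAt.congr_deriv (((((((hasDerivAt_id x).const_mul ν).neg).add_const _).add_const
      _).sub_const _)) ?_
    simp
  have hηy (x y t : ℝ) : HasDerivAt (fun s => η x s t - β t) (2 * μ * ν) y := by
    rw [hη]
    refine HasDerivAt.congr_deriv ((((((hasDerivAt_id y).const_mul (2 * μ * ν)).const_add
      _).add_const _).sub_const _)) ?_
    simp
  have hηt (x y t : ℝ) : HasDerivAt (fun s => η x y s - β s)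
      (4 * ν * (ν ^ 2 - 3 * μ ^ 2) - deriv β t) t := by
    rw [hη]
    refine HasDerivAt.congr_deriv (((((hasDerivAt_id t).const_mul
      (4 * ν * (ν ^ 2 - 3 * μ ^ 2))).const_add _).sub
      ((hβ.differentiable (by simp)) t).hasDerivAt)) ?_
    simp
  have hθx (x y t : ℝ) : HasDerivAt (fun s => θ s y t) (-(Complex.I * μ)) x := by
    rw [hθ]
    refine HasDerivAt.congr_deriv ((((((hasDerivAt_id x).ofReal_comp.const_mul
      (Complex.I * μ)).neg).add_const _).sub_const _)) ?_
    simp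
  have hθy (x y t : ℝ) : HasDerivAt (fun s => θ x s t)
      (Complex.I * (μ ^ 2 - ν ^ 2)) y := by
    rw [hθ]
    refine HasDerivAt.congr_deriv (((((hasDerivAt_id y).ofReal_comp.const_mul
      (Complex.I * ((μ ^ 2 - ν ^ 2 : ℝ) : ℂ))).const_add _).sub_const _)) ?_
    simp
  have hax (x y t : ℝ) : HasDerivAt (fun s => a s y t) (-2 * ν * a x y t) x := by
    rw [ha]
    refine ((hηx x y t).const_mul 2).ofReal_comp.cexp.congr_deriv ?_
    push_cast
    ring
  have hay (x y t : ℝ) : HasDerivAt (fun s => a x s t) (4 * μ * ν * a x y t) y := by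
    rw [ha]
    refine ((hηy x y t).const_mul 2).ofReal_comp.cexp.congr_deriv ?_
    push_cast
    ring
  have hat (x y t : ℝ) : HasDerivAt (fun s => a x y s)
      ((8 * ν * (ν ^ 2 - 3 * μ ^ 2) - 2 * ((deriv β t : ℝ) : ℂ)) * a x y t) t := by
    rw [ha]
    refine ((hηt x y t).const_mul 2).ofReal_comp.cexp.congr_deriv ?_
    push_cast
    ring
  have haB (x y t : ℝ) : ((Real.exp (2 * η x y t) : ℝ) : ℂ)
      = a x y t * ((Real.exp (2 * β t) : ℝ) : ℂ) := by
    simp only [ha]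
    rw [← Complex.ofReal_exp, ← Complex.ofReal_mul, ← Real.exp_add]
    ring_nf
  have hB (t : ℝ) : ((Real.exp (2 * β t) : ℝ) : ℂ) ≠ 0 := by
    exact_mod_cast (Real.exp_pos _).ne'
  have hexpB (x y t : ℝ) (z : ℂ) : Complex.exp (((β t + η x y t : ℝ) : ℂ) + z)
      = Complex.exp (((η x y t - β t : ℝ) : ℂ) + z) * ((Real.exp (2 * β t) : ℝ) : ℂ) := by
    rw [Complex.ofReal_exp, ← Complex.exp_add]
    push_cast
    ring_nf
  have hu' (x y t : ℝ) : u x y t = -2 * ν * (S x y t - T x y t) := by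
    obtain ⟨h1, h2⟩ := hD x y t
    have hE : Complex.exp (f x y t) ≠ 0 := Complex.exp_ne_zero _
    have haE : a x y t = Complex.exp (f x y t) ^ 2 := by
      rw [ha, hf, ← Complex.exp_nat_mul]
      push_cast
      rfl
    have hden : (1 / 4 * Real.exp (2 * f x y t)
          + (Real.exp (-f x y t) - μ / (2 * ν) * Real.exp (f x y t)) ^ 2 : ℝ)
        = -(((Complex.I * ν - μ) * a x y t + 2 * ν) *
          ((Complex.I * ν + μ) * a x y t + -(2 * ν))) / (4 * ν ^ 2 * a x y t) := by
      have h2f : Complex.exp (2 * f x y t) = Complex.exp (f x y t) ^ 2 := by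
        rw [← Complex.exp_nat_mul]
        push_cast
        rfl
      push_cast
      rw [h2f, Complex.exp_neg, haE]
      field_simp
      linear_combination (4 * Complex.exp (f x y t) ^ 4 * ν ^ 2) * hI
    have ha0 : a x y t ≠ 0 := haE ▸ pow_ne_zero 2 hE
    simp only [hu, hS, hT]
    rw [hden]
    generalize hd₁ : (Complex.I * ν - μ) * a x y t + 2 * ν = d₁ at *
    generalize hd₂ : (Complex.I * ν + μ) * a x y t + -(2 * ν) = d₂ at *
    field_simp
    rw [← hd₁, ← hd₂]
    ring
  have hP (x y t : ℝ) : Ψ₁ x y t = e x y t * S x y t := by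
    obtain ⟨h1, h2⟩ := hD x y t
    have hBt := hB t
    simp only [hΨ₁, he, hS]
    rw [haB, hexpB, show (Complex.I * ν - μ) * (a x y t * ((Real.exp (2 * β t) : ℝ) : ℂ))
      + 2 * ν * ((Real.exp (2 * β t) : ℝ) : ℂ)
      = ((Complex.I * ν - μ) * a x y t + 2 * ν) * ((Real.exp (2 * β t) : ℝ) : ℂ) by ring]
    field_simp
  have hQ (x y t : ℝ) : Φ₁ x y t = e' x y t * T x y t := by
    obtain ⟨h1, h2⟩ := hD x y t
    have hBt := hB t
    simp only [hΦ₁, he', hT]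
    rw [haB, sub_eq_add_neg _ (θ x y t), hexpB,
      show (Complex.I * ν + μ) * (a x y t * ((Real.exp (2 * β t) : ℝ) : ℂ))
      - 2 * ν * ((Real.exp (2 * β t) : ℝ) : ℂ)
      = ((Complex.I * ν + μ) * a x y t + -(2 * ν)) * ((Real.exp (2 * β t) : ℝ) : ℂ) by ring,
      ← sub_eq_add_neg]
    field_simp
  have hrel (x y t : ℝ) : (Complex.I * ν - μ) * S x y t + (Complex.I * ν + μ) * T x y t
      = 2 * Complex.I * ν * S x y t * T x y t := by
    obtain ⟨h1, h2⟩ := hD x y t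
    simp only [hS, hT]
    generalize hd₁ : (Complex.I * ν - μ) * a x y t + 2 * ν = d₁ at *
    generalize hd₂ : (Complex.I * ν + μ) * a x y t + -(2 * ν) = d₂ at *
    field_simp
    rw [← hd₁, ← hd₂]
    ring
  have hee (x y t : ℝ) : e x y t * e' x y t
      = -Complex.I / 2 * ((deriv β t : ℝ) : ℂ) * a x y t := by
    have hexp : Complex.exp (((η x y t - β t : ℝ) : ℂ) + θ x y t)
        * Complex.exp (((η x y t - β t : ℝ) : ℂ) - θ x y t) = a x y t := by
      rw [ha, ← Complex.exp_add]
      push_cast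
      ring_nf
    simp only [he, he']
    rw [← hexp, ← hc2]
    linear_combination (c t ^ 2 / 4 * Complex.exp (((η x y t - β t : ℝ) : ℂ) + θ x y t)
        * Complex.exp (((η x y t - β t : ℝ) : ℂ) - θ x y t)) * hI
  have hPQ (x y t : ℝ) : Ψ₁ x y t * Φ₁ x y t
      = ((deriv β t : ℝ) : ℂ) * (S x y t - T x y t) / 2 := by
    obtain ⟨h1, h2⟩ := hD x y t
    rw [hP, hQ, mul_mul_mul_comm, hee]
    simp only [hS, hT]
    generalize hd₁ : (Complex.I * ν - μ) * a x y t + 2 * ν = d₁ at *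
    generalize hd₂ : (Complex.I * ν + μ) * a x y t + -(2 * ν) = d₂ at *
    field_simp
    rw [← hd₁, ← hd₂]
    ring
  have hex (x y t : ℝ) : HasDerivAt (fun s => e s y t)
      ((-ν - Complex.I * μ) * e x y t) x := by
    rw [he]
    refine HasDerivAt.congr_deriv
      (((hηx x y t).ofReal_comp.add (hθx x y t)).cexp.const_mul _) ?_
    simp only [Pi.add_apply]
    push_cast
    ring
  have hey (x y t : ℝ) : HasDerivAt (fun s => e x s t)
      ((2 * μ * ν + Complex.I * (μ ^ 2 - ν ^ 2)) * e x y t) y := by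
    rw [he]
    refine HasDerivAt.congr_deriv
      (((hηy x y t).ofReal_comp.add (hθy x y t)).cexp.const_mul _) ?_
    simp only [Pi.add_apply]
    push_cast
    ring
  have hex' (x y t : ℝ) : HasDerivAt (fun s => e' s y t)
      ((-ν + Complex.I * μ) * e' x y t) x := by
    rw [he']
    refine HasDerivAt.congr_deriv
      (((hηx x y t).ofReal_comp.sub (hθx x y t)).cexp.const_mul _) ?_
    simp only [Pi.sub_apply]
    push_cast
    ring
  have hey' (x y t : ℝ) : HasDerivAt (fun s => e' x s t)
      ((2 * μ * ν - Complex.I * (μ ^ 2 - ν ^ 2)) * e' x y t) y := by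
    rw [he']
    refine HasDerivAt.congr_deriv
      (((hηy x y t).ofReal_comp.sub (hθy x y t)).cexp.const_mul _) ?_
    simp only [Pi.sub_apply]
    push_cast
    ring
  have key := logistic_pair_solution (S := S) (T := T) (w := w)
    (b := fun t => ((deriv β t : ℝ) : ℂ))
    (fun x y t => by rw [hS]; exact hasDerivAt_logistic_s18 (hax x y t) (hD x y t).1)
    (fun x y t => by rw [hS]; exact hasDerivAt_logistic_s18 (hay x y t) (hD x y t).1)
    (fun x y t => by rw [hS]; exact hasDerivAt_logistic_s18 (hat x y t) (hD x y t).1)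
    (fun x y t => by rw [hT]; exact hasDerivAt_logistic_s18 (hax x y t) (hD x y t).2)
    (fun x y t => by rw [hT]; exact hasDerivAt_logistic_s18 (hay x y t) (hD x y t).2)
    (fun x y t => by rw [hT]; exact hasDerivAt_logistic_s18 (hat x y t) (hD x y t).2)
    hex hey hex' hey' hrel hu' hP hQ hPQ (fun x y t => by rw [hw])
  have hofReal : ContDiff ℝ (⊤ : ℕ∞) (fun r : ℝ => (r : ℂ)) := Complex.ofRealCLM.contDiff
  have hcd_t : ContDiff ℝ (⊤ : ℕ∞) (fun p : ℝ × ℝ × ℝ => p.2.2) := by fun_prop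
  have hcd_η : ContDiff ℝ (⊤ : ℕ∞)
      (fun p : ℝ × ℝ × ℝ => η p.1 p.2.1 p.2.2 - β p.2.2) := by
    rw [hη]
    exact ContDiff.sub (by fun_prop) (hβ.comp hcd_t)
  have hcd_θ : ContDiff ℝ (⊤ : ℕ∞) (fun p : ℝ × ℝ × ℝ => θ p.1 p.2.1 p.2.2) := by
    rw [hθ]
    have h1 := hofReal.comp (contDiff_fst : ContDiff ℝ (⊤ : ℕ∞) (fun p : ℝ × ℝ × ℝ => p.1))
    have h2 : ContDiff ℝ (⊤ : ℕ∞) (fun p : ℝ × ℝ × ℝ => (p.2.1 : ℂ)) :=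
      hofReal.comp (by fun_prop)
    have h3 := hofReal.comp hcd_t
    exact (((contDiff_const.mul h1).neg).add (contDiff_const.mul h2)).sub (contDiff_const.mul h3)
  have hcd_a : ContDiff ℝ (⊤ : ℕ∞) (fun p : ℝ × ℝ × ℝ => a p.1 p.2.1 p.2.2) := by
    rw [ha]
    exact (hofReal.comp (contDiff_const.mul hcd_η)).cexp
  have hcd_S : ContDiff ℝ (⊤ : ℕ∞) (fun p : ℝ × ℝ × ℝ => S p.1 p.2.1 p.2.2) := by
    simp only [hS, div_eq_mul_inv]
    exact contDiff_const.mul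
      (((contDiff_const.mul hcd_a).add contDiff_const).inv fun p => (hD _ _ _).1)
  have hcd_T : ContDiff ℝ (⊤ : ℕ∞) (fun p : ℝ × ℝ × ℝ => T p.1 p.2.1 p.2.2) := by
    simp only [hT, div_eq_mul_inv]
    exact contDiff_const.mul
      (((contDiff_const.mul hcd_a).add contDiff_const).inv fun p => (hD _ _ _).2)
  have hcd_c : ContDiff ℝ (⊤ : ℕ∞)
      (fun p : ℝ × ℝ × ℝ => (1 - Complex.I) / 2 * c p.2.2) :=
    contDiff_const.mul (hc.comp hcd_t)
  have hcd_u : ContDiff ℝ (⊤ : ℕ∞) (fun p : ℝ × ℝ × ℝ => u p.1 p.2.1 p.2.2) := by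
    simp only [hu']
    exact contDiff_const.mul (hcd_S.sub hcd_T)
  have hcd_w : ContDiff ℝ (⊤ : ℕ∞) (fun p : ℝ × ℝ × ℝ => w p.1 p.2.1 p.2.2) := by
    rw [hw]
    exact contDiff_const.mul hcd_u
  have hcd_P : ContDiff ℝ (⊤ : ℕ∞) (fun p : ℝ × ℝ × ℝ => Ψ₁ p.1 p.2.1 p.2.2) := by
    simp only [hP, he]
    exact (hcd_c.mul ((hofReal.comp hcd_η).add hcd_θ).cexp).mul hcd_S
  have hcd_Q : ContDiff ℝ (⊤ : ℕ∞) (fun p : ℝ × ℝ × ℝ => Φ₁ p.1 p.2.1 p.2.2) := by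
    simp only [hQ, he']
    exact (hcd_c.mul ((hofReal.comp hcd_η).sub hcd_θ).cexp).mul hcd_T
  refine ⟨fun x y t _ => (key x y t).1, hcd_u.contDiffOn, hcd_w.contDiffOn,
    fun _ => hcd_P.contDiffOn, fun _ => hcd_Q.contDiffOn, fun x y t _ => (key x y t).1,
    fun x y t _ => ?_, fun _ x y t _ => (key x y t).2.2.1, fun _ x y t _ => (key x y t).2.2.2⟩
  rw [Fin.sum_univ_one]
  exact (key x y t).2.1

end
end
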